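/- arXiv:2410.06732 — 9 statements merged into one kernel-verified Lean document; each statement's English description precedes it below -/
import Mathlib

section
/- Let θ : (0,1] → ℝ be locally absolutely continuous on (0,1] with θ ∈ L²(0,1), and suppose the function aθ' extends to an absolutely continuous function on [0,1] whose derivative (aθ')' belongs to L²(0,1). Then the following are equivalent: (i) √a·θ' ∈ L²(0,1) and θ(1) = 0; (ii) aθ extends to an absolutely continuous function on [0,1] with (aθ)' ∈ L²(0,1), (aθ)(0) = (aθ)(1) = 0, and (aθ')(0) = 0. -/
open MeasureTheory Set intervalIntegral Filter Topology

/-- The product rule, in integrated form, for two functions given as primitives of integrable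
functions. -/
theorem integral_deriv_mul_eq_sub_of_primitive {f f' g g' : ℝ → ℝ} {u v : ℝ} (huv : u ≤ v)
    (hf' : IntervalIntegrable f' volume u v) (hg' : IntervalIntegrable g' volume u v)
    (hf : ∀ x ∈ Icc u v, f x = f v - ∫ s in x..v, f' s)
    (hg : ∀ x ∈ Icc u v, g x = g v - ∫ s in x..v, g' s) :
    ∫ x in u..v, (f' x * g x + f x * g' x) = f v * g v - f u * g u := by
  have hac : ∀ {h : ℝ → ℝ} (C : ℝ), IntervalIntegrable h volume u v →
      AbsolutelyContinuousOnInterval (fun x => C + ∫ s in v..x, h s) u v := by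
    intro h C hh
    have hC : AbsolutelyContinuousOnInterval (fun _ : ℝ => C) u v :=
      ((LipschitzWith.const C).lipschitzOnWith (s := uIcc u v)).absolutelyContinuousOnInterval
    exact hC.fun_add (hh.absolutelyContinuousOnInterval_intervalIntegral (by simp))
  have key := (hac (f v) hf').integral_deriv_mul_eq_sub (hac (g v) hg')
  have hval : ∀ {h h' : ℝ → ℝ}, (∀ x ∈ Icc u v, h x = h v - ∫ s in x..v, h' s) →
      ∀ x ∈ Icc u v, h v + ∫ s in v..x, h' s = h x := by
    intro h h' hh x hx
    rw [hh x hx, integral_symm x v]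
    ring
  rw [hval hf v (right_mem_Icc.2 huv), hval hg v (right_mem_Icc.2 huv),
    hval hf u (left_mem_Icc.2 huv), hval hg u (left_mem_Icc.2 huv)] at key
  rw [← key]
  refine integral_congr_ae ?_
  filter_upwards [hf'.ae_hasDerivAt_integral, hg'.ae_hasDerivAt_integral] with x hfx hgx hx
  have hx' : x ∈ uIcc u v := uIoc_subset_uIcc hx
  have hxI : x ∈ Icc u v := by rwa [uIcc_of_le huv] at hx'
  rw [((hfx hx' v right_mem_uIcc).const_add (f v)).deriv,
    ((hgx hx' v right_mem_uIcc).const_add (g v)).deriv, hval hf x hxI, hval hg x hxI]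

/-- A function continuous on `(0,1]` and dominated near `0` by an integrable function is
integrable on `(0,1]`. -/
theorem integrableOn_Ioc_of_eventually_le {g h : ℝ → ℝ} (hh : ContinuousOn h (Ioc (0:ℝ) 1))
    (hg : IntegrableOn g (Ioc (0:ℝ) 1)) (hle : ∀ᶠ x in 𝓝[>] (0:ℝ), |h x| ≤ g x) :
    IntegrableOn h (Ioc (0:ℝ) 1) := by
  obtain ⟨δ, hδ, hsub⟩ := mem_nhdsGT_iff_exists_Ioc_subset.1 hle
  simp only [mem_Ioi] at hδ
  have hmin : 0 < min δ 1 := lt_min hδ one_pos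
  have hleft : IntegrableOn h (Ioc 0 (min δ 1)) := by
    have hss : Ioc 0 (min δ 1) ⊆ Ioc (0:ℝ) 1 := Ioc_subset_Ioc_right (min_le_right _ _)
    refine Integrable.mono' (hg.mono_set hss)
      ((hh.mono hss).aestronglyMeasurable measurableSet_Ioc) ?_
    refine (ae_restrict_iff' measurableSet_Ioc).2 (ae_of_all _ fun x hx => ?_)
    exact hsub ⟨hx.1, hx.2.trans (min_le_left _ _)⟩
  have hright : IntegrableOn h (Icc (min δ 1) 1) :=
    (hh.mono fun x hx => ⟨hmin.trans_le hx.1, hx.2⟩).integrableOn_compact isCompact_Icc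
  refine (hleft.union hright).mono_set fun x hx => ?_
  rcases le_total x (min δ 1) with h' | h'
  · exact Or.inl ⟨hx.1, h'⟩
  · exact Or.inr ⟨h', hx.2⟩

/-- If `w` is continuous and positive on `(0,1]` but not integrable there, a function `f` with
`f² w` integrable cannot have a nonzero limit at `0`. -/
theorem eq_zero_of_tendsto_of_integrableOn_sq_mul {f w : ℝ → ℝ} {L : ℝ}
    (hw : ContinuousOn w (Ioc (0:ℝ) 1)) (hwpos : ∀ x ∈ Ioc (0:ℝ) 1, 0 < w x)
    (hwnot : ¬ IntegrableOn w (Ioc (0:ℝ) 1))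
    (hf : IntegrableOn (fun x => f x ^ 2 * w x) (Ioc (0:ℝ) 1))
    (hL : Tendsto f (𝓝[>] 0) (𝓝 L)) : L = 0 := by
  by_contra hne
  have hL2 : 0 < L ^ 2 := by positivity
  refine hwnot (integrableOn_Ioc_of_eventually_le hw (hf.const_mul (2 / L ^ 2)) ?_)
  filter_upwards [(hL.pow 2).eventually_const_lt (half_lt_self hL2),
    Ioc_mem_nhdsGT (zero_lt_one (α := ℝ))] with x hx hx01
  have hwx := hwpos x hx01
  rw [abs_of_pos hwx, ← mul_assoc]
  refine le_mul_of_one_le_left hwx.le ?_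
  rw [div_mul_eq_mul_div, le_div_iff₀ hL2]
  linarith

/-- A primitive, vanishing at `0`, of a square-integrable function is `O(√x)`. -/
theorem abs_integral_le_mul_sqrt {g : ℝ → ℝ} (hg : IntervalIntegrable g volume 0 1)
    (hg2 : IntegrableOn (fun x => g x ^ 2) (Ioc (0:ℝ) 1)) {x : ℝ} (hx : x ∈ Ioc (0:ℝ) 1) :
    |∫ s in (0:ℝ)..x, g s| ≤ ((∫ s in (0:ℝ)..1, g s ^ 2) + 1) * √x := by
  have hsx : 0 < √x := Real.sqrt_pos.2 hx.1
  have hss : uIcc 0 x ⊆ uIcc (0:ℝ) 1 := by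
    rw [uIcc_of_le hx.1.le, uIcc_of_le zero_le_one]
    exact Icc_subset_Icc_right hx.2
  have hg2' : IntervalIntegrable (fun s => g s ^ 2) volume 0 1 :=
    (intervalIntegrable_iff_integrableOn_Ioc_of_le zero_le_one).2 hg2
  have hg2x := hg2'.mono_set hss
  have hmono : ∫ s in (0:ℝ)..x, g s ^ 2 ≤ ∫ s in (0:ℝ)..1, g s ^ 2 :=
    integral_mono_interval le_rfl hx.1.le hx.2 (ae_of_all _ fun s => sq_nonneg _) hg2'
  calc |∫ s in (0:ℝ)..x, g s| ≤ ∫ s in (0:ℝ)..x, |g s| := abs_integral_le_integral_abs hx.1.le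
    _ ≤ ∫ s in (0:ℝ)..x, (√x * g s ^ 2 + (√x)⁻¹) := by
        refine integral_mono_on hx.1.le (hg.mono_set hss).abs
          ((hg2x.const_mul _).add intervalIntegrable_const) fun s _ => ?_
        have hrhs : √x * g s ^ 2 + (√x)⁻¹ = (√x)⁻¹ * ((√x * |g s|) ^ 2 + 1) := by
          rw [mul_pow, sq_abs]
          field_simp
        have hlhs : |g s| = (√x)⁻¹ * (√x * |g s|) := by field_simp
        rw [hrhs]
        nth_rw 1 [hlhs]
        gcongr
        nlinarith [sq_nonneg (√x * |g s| - 1), abs_nonneg (g s)]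
    _ = √x * (∫ s in (0:ℝ)..x, g s ^ 2) + √x := by
        rw [integral_add (hg2x.const_mul _) intervalIntegrable_const,
          intervalIntegral.integral_const_mul, intervalIntegral.integral_const, sub_zero,
          smul_eq_mul, ← div_eq_mul_inv, Real.div_sqrt]
    _ ≤ ((∫ s in (0:ℝ)..1, g s ^ 2) + 1) * √x := by nlinarith

/-- (Strongly degenerate case.) For `θ ∈ L²(0,1)` locally absolutely
continuous on `(0,1]` whose weighted derivative `aθ'` extends to an absolutely continuous
function `b` on `[0,1]` with `b' = (aθ')' ∈ L²(0,1)`, the following are equivalent: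
(i) `√a·θ' ∈ L²(0,1)` and `θ 1 = 0`;
(ii) `aθ` extends to an absolutely continuous function `c` on `[0,1]` with
`c' = (aθ)' ∈ L²(0,1)`, `c 0 = c 1 = 0`, and `(aθ')(0) = b 0 = 0`. -/
theorem stmt_1 (a : ℝ → ℝ)
    (haC1 : ContDiffOn ℝ 1 a (Icc (0:ℝ) 1))
    (ha0 : a 0 = 0)
    (hapos : ∀ x ∈ Ioc (0:ℝ) 1, 0 < a x)
    (hanotL1 : ¬ IntegrableOn (fun x => (a x)⁻¹) (Ioc (0:ℝ) 1) volume)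
    (hasqrtL1 : IntegrableOn (fun x => (Real.sqrt (a x))⁻¹) (Ioc (0:ℝ) 1) volume)
    (θ θ' : ℝ → ℝ)
    (hθL2 : MemLp θ 2 (volume.restrict (Ioc (0:ℝ) 1)))
    (hθ'locint : ∀ ε ∈ Ioc (0:ℝ) 1, IntervalIntegrable θ' volume ε 1)
    (hθlocAC : ∀ x ∈ Ioc (0:ℝ) 1, θ x = θ 1 - ∫ s in x..(1:ℝ), θ' s)
    (b b' : ℝ → ℝ)
    (hb : ∀ x ∈ Ioc (0:ℝ) 1, b x = a x * θ' x)
    (hb'int : IntervalIntegrable b' volume 0 1)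
    (hb'L2 : MemLp b' 2 (volume.restrict (Ioc (0:ℝ) 1)))
    (hbAC : ∀ x ∈ Icc (0:ℝ) 1, b x = b 0 + ∫ s in (0:ℝ)..x, b' s) :
    (MemLp (fun x => Real.sqrt (a x) * θ' x) 2 (volume.restrict (Ioc (0:ℝ) 1)) ∧ θ 1 = 0)
    ↔
    (∃ c c' : ℝ → ℝ,
      (∀ x ∈ Ioc (0:ℝ) 1, c x = a x * θ x) ∧
      IntervalIntegrable c' volume 0 1 ∧
      MemLp c' 2 (volume.restrict (Ioc (0:ℝ) 1)) ∧
      (∀ x ∈ Icc (0:ℝ) 1, c x = c 0 + ∫ s in (0:ℝ)..x, c' s) ∧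
      c 0 = 0 ∧ c 1 = 0 ∧ b 0 = 0) := by
  have h01 : (0:ℝ) ≤ 1 := zero_le_one
  have hsub : Ioc (0:ℝ) 1 ⊆ Icc 0 1 := Ioc_subset_Icc_self
  have ha : ContinuousOn a (Icc (0:ℝ) 1) := haC1.continuousOn
  have hainv : ContinuousOn (fun x => (a x)⁻¹) (Ioc (0:ℝ) 1) :=
    (ha.mono hsub).inv₀ fun x hx => (hapos x hx).ne'
  have hainvpos : ∀ x ∈ Ioc (0:ℝ) 1, 0 < (a x)⁻¹ := fun x hx => inv_pos.2 (hapos x hx)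
  have hbcont : ContinuousOn b (Icc (0:ℝ) 1) := by
    have h := continuousOn_primitive_interval' hb'int (a := 0) left_mem_uIcc
    rw [uIcc_of_le h01] at h
    exact (continuousOn_const.add h).congr hbAC
  have hθ'eq : ∀ x ∈ Ioc (0:ℝ) 1, θ' x = b x * (a x)⁻¹ := fun x hx => by
    rw [hb x hx]
    field_simp [(hapos x hx).ne']
  have hθ'cont : ContinuousOn θ' (Ioc (0:ℝ) 1) :=
    ((hbcont.mono hsub).mul hainv).congr hθ'eq
  have hmeas : AEStronglyMeasurable (fun x => √(a x) * θ' x) (volume.restrict (Ioc (0:ℝ) 1)) :=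
    (((ha.mono hsub).sqrt).mul hθ'cont).aestronglyMeasurable measurableSet_Ioc
  have hsq : ∀ x ∈ Ioc (0:ℝ) 1, (√(a x) * θ' x) ^ 2 = b x * θ' x := fun x hx => by
    rw [mul_pow, Real.sq_sqrt (hapos x hx).le, hb x hx]
    ring
  have hbright : ∀ x ∈ Icc (0:ℝ) 1, b x = b 1 - ∫ s in x..(1:ℝ), b' s := fun x hx => by
    have h1 : IntervalIntegrable b' volume 0 x := hb'int.mono_set (by
      rw [uIcc_of_le hx.1, uIcc_of_le h01]; exact Icc_subset_Icc_right hx.2)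
    have h2 : IntervalIntegrable b' volume x 1 := hb'int.mono_set (by
      rw [uIcc_of_le hx.2, uIcc_of_le h01]; exact Icc_subset_Icc_left hx.1)
    rw [hbAC x hx, hbAC 1 (right_mem_Icc.2 h01), ← integral_add_adjacent_intervals h1 h2]
    ring
  have hθsq : IntegrableOn (fun x => θ x ^ 2) (Ioc (0:ℝ) 1) :=
    (memLp_two_iff_integrable_sq hθL2.aestronglyMeasurable).1 hθL2
  constructor
  · rintro ⟨hL2, hθ1⟩
    have hb0 : b 0 = 0 := by
      have hint := (memLp_two_iff_integrable_sq hmeas).1 hL2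
      refine eq_zero_of_tendsto_of_integrableOn_sq_mul hainv hainvpos hanotL1
        (IntegrableOn.congr_fun (f := fun x => (√(a x) * θ' x) ^ 2) hint (fun x hx => ?_)
          measurableSet_Ioc) (f := b) ?_
      · refine (hsq x hx).trans ?_
        rw [hθ'eq x hx]
        ring
      · have h := hbcont 0 (left_mem_Icc.2 h01)
        rw [← nhdsWithin_Ioc_eq_nhdsGT (zero_lt_one (α := ℝ))]
        exact h.mono hsub
    set a' : ℝ → ℝ := derivWithin a (Icc 0 1)
    have ha'cont : ContinuousOn a' (Icc (0:ℝ) 1) :=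
      haC1.continuousOn_derivWithin (uniqueDiffOn_Icc one_pos) le_rfl
    have ha'top : MemLp a' ⊤ (volume.restrict (Ioc (0:ℝ) 1)) := by
      obtain ⟨C, hC⟩ := isCompact_Icc.exists_bound_of_continuousOn ha'cont
      exact memLp_top_of_bound ((ha'cont.mono hsub).aestronglyMeasurable measurableSet_Ioc) C
        ((ae_restrict_iff' measurableSet_Ioc).2 (ae_of_all _ fun x hx => hC x (hsub hx)))
    have hbL2 : MemLp b 2 (volume.restrict (Ioc (0:ℝ) 1)) := by
      obtain ⟨C, hC⟩ := isCompact_Icc.exists_bound_of_continuousOn hbcont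
      exact MemLp.of_bound ((hbcont.mono hsub).aestronglyMeasurable measurableSet_Ioc) C
        ((ae_restrict_iff' measurableSet_Ioc).2 (ae_of_all _ fun x hx => hC x (hsub hx)))
    have hc'L2 : MemLp (fun x => a' x * θ x + b x) 2 (volume.restrict (Ioc (0:ℝ) 1)) :=
      (hθL2.mul' ha'top).add hbL2
    have hc'int : IntervalIntegrable (fun x => a' x * θ x + b x) volume 0 1 :=
      (intervalIntegrable_iff_integrableOn_Ioc_of_le h01).2 (hc'L2.integrable one_le_two)
    have ha'int : ∀ x ∈ Icc (0:ℝ) 1, IntervalIntegrable a' volume x 1 := fun x hx =>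
      (ha'cont.mono (Icc_subset_Icc_left hx.1)).intervalIntegrable_of_Icc hx.2
    have haright : ∀ x ∈ Icc (0:ℝ) 1, a x = a 1 - ∫ s in x..(1:ℝ), a' s := fun x hx => by
      rw [integral_eq_sub_of_hasDerivAt_of_le hx.2 (ha.mono (Icc_subset_Icc_left hx.1)) ?_
        (ha'int x hx)]
      · ring
      · intro y hy
        have hy' : y ∈ Ioo (0:ℝ) 1 := ⟨hx.1.trans_lt hy.1, hy.2⟩
        exact (haC1.differentiableOn one_ne_zero y
          (Ioo_subset_Icc_self hy')).hasDerivWithinAt.hasDerivAt (Icc_mem_nhds hy'.1 hy'.2)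
    have hprod : ∀ x ∈ Ioc (0:ℝ) 1, a x * θ x = -∫ s in x..(1:ℝ), (a' s * θ s + b s) := by
      intro x hx
      have h := integral_deriv_mul_eq_sub_of_primitive hx.2 (ha'int x (hsub hx))
        (hθ'locint x hx) (fun y hy => haright y ⟨hx.1.le.trans hy.1, hy.2⟩)
        (fun y hy => hθlocAC y ⟨hx.1.trans_le hy.1, hy.2⟩)
      rw [hθ1, mul_zero, zero_sub] at h
      rw [← neg_eq_iff_eq_neg, ← h]
      refine integral_congr fun y hy => ?_
      rw [uIcc_of_le hx.2] at hy
      simp only [hb y ⟨hx.1.trans_le hy.1, hy.2⟩]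
    have hlim : Tendsto (fun x => a x * θ x) (𝓝[>] 0)
        (𝓝 (-∫ s in (0:ℝ)..1, (a' s * θ s + b s))) := by
      have h := continuousOn_primitive_interval' hc'int.symm (a := 1) left_mem_uIcc
      rw [uIcc_of_ge h01] at h
      have h0 := h 0 (left_mem_Icc.2 h01)
      rw [← integral_symm, ← nhdsWithin_Ioc_eq_nhdsGT (zero_lt_one (α := ℝ))]
      refine (h0.mono hsub).tendsto.congr' ?_
      filter_upwards [self_mem_nhdsWithin] with x hx
      rw [hprod x hx, integral_symm]
    have hI : ∫ s in (0:ℝ)..1, (a' s * θ s + b s) = 0 := by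
      rw [← neg_eq_zero]
      refine eq_zero_of_tendsto_of_integrableOn_sq_mul hainv hainvpos hanotL1 ?_ hlim
      obtain ⟨C, hC⟩ := isCompact_Icc.exists_bound_of_continuousOn ha
      refine IntegrableOn.congr_fun (f := fun x => a x * θ x ^ 2) ?_ (fun x hx => ?_)
        measurableSet_Ioc
      · exact hθsq.bdd_mul ((ha.mono hsub).aestronglyMeasurable measurableSet_Ioc)
          ((ae_restrict_iff' measurableSet_Ioc).2 (ae_of_all _ fun x hx => hC x (hsub hx)))
      · field_simp [(hapos x hx).ne']
    refine ⟨fun x => a x * θ x, fun x => a' x * θ x + b x, fun _ _ => rfl, hc'int, hc'L2,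
      fun x hx => ?_, by simp [ha0], by simp [hθ1], hb0⟩
    simp only [ha0, zero_mul, zero_add]
    rcases hx.1.eq_or_lt with rfl | hx0
    · simp [ha0]
    · have h1 : IntervalIntegrable (fun x => a' x * θ x + b x) volume 0 x := hc'int.mono_set (by
        rw [uIcc_of_le hx.1, uIcc_of_le h01]; exact Icc_subset_Icc_right hx.2)
      have h2 : IntervalIntegrable (fun x => a' x * θ x + b x) volume x 1 := hc'int.mono_set (by
        rw [uIcc_of_le hx.2, uIcc_of_le h01]; exact Icc_subset_Icc_left hx.1)
      rw [hprod x ⟨hx0, hx.2⟩]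
      linarith [integral_add_adjacent_intervals h1 h2]
  · rintro ⟨c, c', hc, -, -, -, -, hc1, hb0⟩
    have h1mem : (1:ℝ) ∈ Ioc (0:ℝ) 1 := right_mem_Ioc.2 one_pos
    have hθ1 : θ 1 = 0 := by
      have h := hc 1 h1mem
      rw [hc1] at h
      exact (mul_eq_zero.1 h.symm).resolve_left (hapos 1 h1mem).ne'
    refine ⟨(memLp_two_iff_integrable_sq hmeas).2 ?_, hθ1⟩
    set K : ℝ := (∫ s in (0:ℝ)..1, b' s ^ 2) + 1
    have hKpos : 0 < K :=
      add_pos_of_nonneg_of_pos (integral_nonneg h01 fun s _ => sq_nonneg _) one_pos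
    have hbK : ∀ x ∈ Ioc (0:ℝ) 1, |b x| ≤ K * √x := fun x hx => by
      rw [hbAC x (hsub hx), hb0, zero_add]
      exact abs_integral_le_mul_sqrt hb'int
        ((memLp_two_iff_integrable_sq hb'L2.aestronglyMeasurable).1 hb'L2) hx
    have hfreq : ∃ᶠ x in 𝓝[>] (0:ℝ), x ∈ Ioc (0:ℝ) 1 ∧ |b x * θ x| ≤ K := by
      intro hev
      have hcont : ContinuousOn (fun x : ℝ => x⁻¹) (Ioc (0:ℝ) 1) :=
        continuousOn_id.inv₀ fun x hx => hx.1.ne'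
      have hint : IntegrableOn (fun x : ℝ => x⁻¹) (Ioc (0:ℝ) 1) := by
        refine integrableOn_Ioc_of_eventually_le hcont hθsq ?_
        filter_upwards [hev, Ioc_mem_nhdsGT (zero_lt_one (α := ℝ))] with x hx hx01
        have hlt : K < |b x * θ x| := not_le.1 fun h => hx ⟨hx01, h⟩
        have hlt' : K * 1 < K * (√x * |θ x|) := by
          rw [abs_mul] at hlt
          nlinarith [hbK x hx01, abs_nonneg (θ x)]
        have h1 : 1 < √x * |θ x| := lt_of_mul_lt_mul_left hlt' hKpos.le
        have h2 : 1 ≤ (√x * |θ x|) ^ 2 := one_le_pow₀ h1.le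
        rw [mul_pow, Real.sq_sqrt hx01.1.le, sq_abs] at h2
        rw [abs_of_pos (inv_pos.2 hx01.1), inv_le_iff_one_le_mul₀' hx01.1]
        exact h2
      have h := intervalIntegrable_inv_iff.1
        ((intervalIntegrable_iff_integrableOn_Ioc_of_le h01).2 hint)
      simp at h
    obtain ⟨ε, hεlim, hε⟩ := exists_seq_forall_of_frequently hfreq
    have hprodint : IntegrableOn (fun x => b' x * θ x) (Ioc (0:ℝ) 1) :=
      memLp_one_iff_integrable.1 (hθL2.mul' hb'L2)
    have hparts : ∀ n, IntervalIntegrable (fun x => b x * θ' x) volume (ε n) 1 := fun n =>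
      (ContinuousOn.mono ((hbcont.mono hsub).mul hθ'cont)
        fun _ hx => ⟨(hε n).1.1.trans_le hx.1, hx.2⟩).intervalIntegrable_of_Icc (hε n).1.2
    refine IntegrableOn.congr_fun (f := fun x => b x * θ' x) ?_ (fun x hx => (hsq x hx).symm)
      measurableSet_Ioc
    refine integrableOn_Ioc_of_intervalIntegral_norm_bounded_left
      (I := K + ∫ x in Ioc (0:ℝ) 1, |b' x * θ x|) (a := ε) (l := atTop)
      (fun n => (intervalIntegrable_iff_integrableOn_Ioc_of_le (hε n).1.2).1 (hparts n))
      (hεlim.mono_right nhdsWithin_le_nhds) (Eventually.of_forall fun n => ?_)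
    obtain ⟨hεn, hbθ⟩ := hε n
    have hss : Ioc (ε n) 1 ⊆ Ioc (0:ℝ) 1 := Ioc_subset_Ioc_left hεn.1.le
    have hprodint' : IntervalIntegrable (fun x => b' x * θ x) volume (ε n) 1 :=
      (intervalIntegrable_iff_integrableOn_Ioc_of_le hεn.2).2 (hprodint.mono_set hss)
    have h := integral_deriv_mul_eq_sub_of_primitive hεn.2
      (hb'int.mono_set (by
        rw [uIcc_of_le hεn.2, uIcc_of_le h01]; exact Icc_subset_Icc_left hεn.1.le))
      (hθ'locint _ hεn) (fun y hy => hbright y ⟨hεn.1.le.trans hy.1, hy.2⟩)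
      (fun y hy => hθlocAC y ⟨hεn.1.trans_le hy.1, hy.2⟩)
    rw [hθ1, mul_zero, zero_sub, integral_add hprodint' (hparts n)] at h
    have hnorm : ∫ x in Ioc (ε n) 1, ‖b x * θ' x‖ = ∫ x in (ε n)..1, b x * θ' x := by
      rw [integral_of_le hεn.2]
      refine setIntegral_congr_fun measurableSet_Ioc fun x hx => ?_
      rw [← hsq x (hss hx)]
      exact Real.norm_of_nonneg (sq_nonneg _)
    have hbound : |∫ x in (ε n)..1, b' x * θ x| ≤ ∫ x in Ioc (0:ℝ) 1, |b' x * θ x| := by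
      refine (abs_integral_le_integral_abs hεn.2).trans ?_
      rw [integral_of_le hεn.2]
      exact setIntegral_mono_set hprodint.abs (ae_of_all _ fun x => abs_nonneg _)
        hss.eventuallyLE
    rw [hnorm]
    linarith [neg_abs_le (b (ε n) * θ (ε n)), neg_abs_le (∫ x in (ε n)..1, b' x * θ x)]
end

section
/- Let θ : (0,1] → ℝ be locally absolutely continuous with θ ∈ L²(0,1) and θ(1) = 0, and suppose aθ' extends to an absolutely continuous function on [0,1] with (aθ')' ∈ L²(0,1) and (aθ')(0) = 0. Then √a·θ' ∈ L²(0,1) and ∫₀¹ (aθ')'(s) θ(s) ds = − ∫₀¹ a(s) |θ'(s)|² ds. -/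
open MeasureTheory Set intervalIntegral Filter Topology

/-- Integration by parts for two functions that are primitives of integrable functions. -/
theorem integral_mul_eq_sub_of_eq_add_integral {u v u' v' : ℝ → ℝ} {a b : ℝ}
    (hu' : IntervalIntegrable u' volume a b) (hv' : IntervalIntegrable v' volume a b)
    (hu : ∀ x ∈ uIcc a b, u x = u a + ∫ s in a..x, u' s)
    (hv : ∀ x ∈ uIcc a b, v x = v a + ∫ s in a..x, v' s) :
    ∫ x in a..b, u' x * v x = u b * v b - u a * v a - ∫ x in a..b, u x * v' x := by
  have ac {w : ℝ → ℝ} (k : ℝ) (hw : IntervalIntegrable w volume a b) :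
      AbsolutelyContinuousOnInterval (fun x => k + ∫ s in a..x, w s) a b :=
    ((LipschitzWith.const k).lipschitzOnWith.absolutelyContinuousOnInterval).fun_add
      (hw.absolutelyContinuousOnInterval_intervalIntegral left_mem_uIcc)
  have parts := (ac (v a) hv').integral_mul_deriv_eq_deriv_mul (ac (u a) hu')
  rw [← hu b right_mem_uIcc, ← hv b right_mem_uIcc, integral_same, integral_same, add_zero,
    add_zero] at parts
  have left : ∫ x in a..b, u' x * v x =
      ∫ x in a..b, (v a + ∫ s in a..x, v' s) * deriv (fun y => u a + ∫ s in a..y, u' s) x := by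
    refine integral_congr_ae ?_
    filter_upwards [hu'.ae_hasDerivAt_integral] with x hx hxm
    have hx' := uIoc_subset_uIcc hxm
    rw [((hx hx' a left_mem_uIcc).const_add (u a)).deriv, hv x hx', mul_comm]
  have right : ∫ x in a..b, u x * v' x =
      ∫ x in a..b, deriv (fun y => v a + ∫ s in a..y, v' s) x * (u a + ∫ s in a..x, u' s) := by
    refine integral_congr_ae ?_
    filter_upwards [hv'.ae_hasDerivAt_integral] with x hx hxm
    have hx' := uIoc_subset_uIcc hxm
    rw [((hx hx' a left_mem_uIcc).const_add (v a)).deriv, hu x hx', mul_comm]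
  rw [left, right, parts]
  ring

/-- The Cauchy–Schwarz inequality against the constant function `1`. -/
theorem sq_intervalIntegral_le_mul_integral_sq {f : ℝ → ℝ} {a b : ℝ} (hab : a ≤ b)
    (hf : IntervalIntegrable f volume a b)
    (hf2 : IntervalIntegrable (fun x => f x ^ 2) volume a b) :
    (∫ x in a..b, f x) ^ 2 ≤ (b - a) * ∫ x in a..b, f x ^ 2 := by
  rcases hab.eq_or_lt with rfl | hlt
  · simp
  set I := ∫ x in a..b, f x
  have expand : ∫ x in a..b, ((b - a) * f x - I) ^ 2 =
      (b - a) * ((b - a) * (∫ x in a..b, f x ^ 2) - I ^ 2) := by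
    have : ∀ x, ((b - a) * f x - I) ^ 2 =
        (b - a) ^ 2 * f x ^ 2 - 2 * (b - a) * I * f x + I ^ 2 := fun x => by ring
    simp_rw [this]
    rw [integral_add ((hf2.const_mul _).sub (hf.const_mul _)) intervalIntegrable_const,
      integral_sub (hf2.const_mul _) (hf.const_mul _), intervalIntegral.integral_const_mul,
      intervalIntegral.integral_const_mul, intervalIntegral.integral_const, smul_eq_mul]
    ring
  have nonneg : 0 ≤ ∫ x in a..b, ((b - a) * f x - I) ^ 2 :=
    integral_nonneg hab fun x _ => sq_nonneg _
  rw [expand] at nonneg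
  linarith [nonneg_of_mul_nonneg_right nonneg (sub_pos.2 hlt)]

/-- If `g` is square-integrable near `0` and `f x ^ 2 = O(x)`, then `f * g` gets arbitrarily small
arbitrarily close to `0`, since otherwise `x⁻¹` would be integrable. -/
theorem exists_abs_mul_lt_of_sq_le_mul {f g : ℝ → ℝ} {M c : ℝ} (hc : 0 < c)
    (hg : MemLp g 2 (volume.restrict (Ioc 0 c))) (hf : ∀ x ∈ Ioc 0 c, f x ^ 2 ≤ x * M)
    {δ : ℝ} (hδ : 0 < δ) : ∃ x ∈ Ioc 0 c, |f x * g x| < δ := by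
  by_contra! h
  have hg2 : IntegrableOn (fun x => M / δ ^ 2 * g x ^ 2) (Ioc 0 c) :=
    ((memLp_two_iff_integrable_sq hg.1).1 hg).const_mul _
  have hinv : IntervalIntegrable (fun x : ℝ => x⁻¹) volume 0 c := by
    rw [intervalIntegrable_iff_integrableOn_Ioc_of_le hc.le]
    refine hg2.mono' measurable_inv.aestronglyMeasurable ?_
    filter_upwards [ae_restrict_mem measurableSet_Ioc] with x hx
    have hx0 := hx.1
    have lower : δ ^ 2 ≤ f x ^ 2 * g x ^ 2 := by
      rw [← mul_pow, ← sq_abs (f x * g x)]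
      exact pow_le_pow_left₀ hδ.le (h x hx) 2
    have upper := mul_le_mul_of_nonneg_right (hf x hx) (sq_nonneg (g x))
    rw [Real.norm_of_nonneg (inv_nonneg.2 hx0.le), inv_eq_one_div, div_mul_eq_mul_div,
      div_le_div_iff₀ hx0 (by positivity)]
    linarith
  simp [intervalIntegrable_inv_iff, hc.ne, hc.le] at hinv



/-- (Strongly degenerate case.) If `θ ∈ L²(0,1)` is locally absolutely
continuous on `(0,1]` with `θ 1 = 0`, and `aθ'` extends to an absolutely continuous
function `b` on `[0,1]` with `b' = (aθ')' ∈ L²(0,1)` and `b 0 = (aθ')(0) = 0`, then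
`√a·θ' ∈ L²(0,1)` and `∫₀¹ (aθ')' θ = −∫₀¹ a |θ'|²`. -/
theorem stmt_2 (a : ℝ → ℝ)
    (haC1 : ContDiffOn ℝ 1 a (Icc (0:ℝ) 1))
    (ha0 : a 0 = 0)
    (hapos : ∀ x ∈ Ioc (0:ℝ) 1, 0 < a x)
    (hanotL1 : ¬ IntegrableOn (fun x => (a x)⁻¹) (Ioc (0:ℝ) 1) volume)
    (hasqrtL1 : IntegrableOn (fun x => (Real.sqrt (a x))⁻¹) (Ioc (0:ℝ) 1) volume)
    (θ θ' : ℝ → ℝ)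
    (hθL2 : MemLp θ 2 (volume.restrict (Ioc (0:ℝ) 1)))
    (hθ'locint : ∀ ε ∈ Ioc (0:ℝ) 1, IntervalIntegrable θ' volume ε 1)
    (hθlocAC : ∀ x ∈ Ioc (0:ℝ) 1, θ x = θ 1 - ∫ s in x..(1:ℝ), θ' s)
    (hθ1 : θ 1 = 0)
    (b b' : ℝ → ℝ)
    (hb : ∀ x ∈ Ioc (0:ℝ) 1, b x = a x * θ' x)
    (hb'int : IntervalIntegrable b' volume 0 1)
    (hb'L2 : MemLp b' 2 (volume.restrict (Ioc (0:ℝ) 1)))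
    (hbAC : ∀ x ∈ Icc (0:ℝ) 1, b x = b 0 + ∫ s in (0:ℝ)..x, b' s)
    (hb0 : b 0 = 0) :
    MemLp (fun x => Real.sqrt (a x) * θ' x) 2 (volume.restrict (Ioc (0:ℝ) 1)) ∧
    ∫ s in (0:ℝ)..1, b' s * θ s = - ∫ s in (0:ℝ)..1, a s * (θ' s) ^ 2 := by
  have hb'sq : IntervalIntegrable (fun x => b' x ^ 2) volume 0 1 :=
    (intervalIntegrable_iff_integrableOn_Ioc_of_le zero_le_one).2
      ((memLp_two_iff_integrable_sq hb'L2.1).1 hb'L2)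
  have hb'θ : IntervalIntegrable (fun x => b' x * θ x) volume 0 1 :=
    (intervalIntegrable_iff_integrableOn_Ioc_of_le zero_le_one).2 (hb'L2.integrable_mul hθL2)
  have hbsq : ∀ x ∈ Ioc (0 : ℝ) 1, b x ^ 2 ≤ x * ∫ s in (0 : ℝ)..1, b' s ^ 2 := by
    intro x hx
    have sub : uIcc 0 x ⊆ uIcc (0 : ℝ) 1 := by
      rw [uIcc_of_le hx.1.le, uIcc_of_le zero_le_one]
      exact Icc_subset_Icc_right hx.2
    have cs := sq_intervalIntegral_le_mul_integral_sq hx.1.le (hb'int.mono_set sub)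
      (hb'sq.mono_set sub)
    rw [hbAC x (Ioc_subset_Icc_self hx), hb0, zero_add]
    rw [sub_zero] at cs
    refine cs.trans (mul_le_mul_of_nonneg_left ?_ hx.1.le)
    exact integral_mono_interval le_rfl hx.1.le hx.2 (ae_of_all _ fun s => sq_nonneg _) hb'sq
  have hbcont : ContinuousOn b (Icc 0 1) := by
    have h := continuousOn_primitive_interval' hb'int left_mem_uIcc
    rw [uIcc_of_le zero_le_one] at h
    exact (h.const_add (b 0)).congr hbAC
  have energy_int : ∀ ε ∈ Ioc (0 : ℝ) 1,
      IntervalIntegrable (fun x => a x * θ' x ^ 2) volume ε 1 := by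
    intro ε hε
    refine ((hθ'locint ε hε).continuousOn_mul (f := θ') (g := b) ?_).congr ?_
    · rw [uIcc_of_le hε.2]
      exact hbcont.mono (Icc_subset_Icc_left hε.1.le)
    · intro x hx
      rw [uIoc_of_le hε.2] at hx
      simp only [hb x ⟨hε.1.trans hx.1, hx.2⟩]
      ring
  have parts : ∀ ε ∈ Ioc (0 : ℝ) 1, ∫ x in ε..1, a x * θ' x ^ 2 =
      -(b ε * θ ε) - ∫ x in ε..1, b' x * θ x := by
    intro ε hε
    have sub : ∀ x ∈ Icc ε 1, x ∈ Ioc (0 : ℝ) 1 := fun x hx => ⟨hε.1.trans_le hx.1, hx.2⟩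
    have b'int : ∀ x ∈ Icc (0 : ℝ) 1, IntervalIntegrable b' volume 0 x := fun x hx =>
      hb'int.mono_set (by
        rw [uIcc_of_le hx.1, uIcc_of_le zero_le_one]
        exact Icc_subset_Icc_right hx.2)
    have εmem := Ioc_subset_Icc_self hε
    have h := integral_mul_eq_sub_of_eq_add_integral (u := b) (v := θ)
      ((b'int ε εmem).symm.trans hb'int) (hθ'locint ε hε) ?_ ?_
    · have cong : ∫ x in ε..1, b x * θ' x = ∫ x in ε..1, a x * θ' x ^ 2 := by
        refine integral_congr fun x hx => ?_
        rw [uIcc_of_le hε.2] at hx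
        simp only [hb x (sub x hx)]
        ring
      rw [cong, hθ1] at h
      linarith
    · intro x hx
      rw [uIcc_of_le hε.2] at hx
      have xmem := Ioc_subset_Icc_self (sub x hx)
      rw [hbAC x xmem, hbAC ε εmem, add_assoc, integral_add_adjacent_intervals (b'int ε εmem)
        ((b'int ε εmem).symm.trans (b'int x xmem))]
    · intro x hx
      rw [uIcc_of_le hε.2] at hx
      have hx1 := hθ'locint x (sub x hx)
      rw [hθlocAC x (sub x hx), hθlocAC ε hε, ← integral_add_adjacent_intervals
        ((hθ'locint ε hε).trans hx1.symm) hx1]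
      ring
  have seq : ∀ n : ℕ, ∃ x ∈ Ioc (0 : ℝ) (1 / (n + 1)), |b x * θ x| < 1 / (n + 1) := by
    intro n
    have sub : Ioc (0 : ℝ) (1 / (n + 1)) ⊆ Ioc 0 1 := Ioc_subset_Ioc_right
      ((div_le_one (by positivity)).2 (by linarith [n.cast_nonneg (α := ℝ)]))
    exact exists_abs_mul_lt_of_sq_le_mul (by positivity)
      (hθL2.mono_measure (Measure.restrict_mono sub le_rfl)) (fun x hx => hbsq x (sub hx))
      (by positivity)
  choose ε hεmem hεlt using seq
  have hε : ∀ n, ε n ∈ Ioc (0 : ℝ) 1 := fun n => ⟨(hεmem n).1, (hεmem n).2.trans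
    ((div_le_one (by positivity)).2 (by linarith [n.cast_nonneg (α := ℝ)]))⟩
  have εlim : Tendsto ε atTop (𝓝 0) :=
    squeeze_zero (fun n => (hε n).1.le) (fun n => (hεmem n).2)
      tendsto_one_div_add_atTop_nhds_zero_nat
  have bθlim : Tendsto (fun n => b (ε n) * θ (ε n)) atTop (𝓝 0) :=
    squeeze_zero_norm (fun n => (hεlt n).le) tendsto_one_div_add_atTop_nhds_zero_nat
  have integral_lim {f : ℝ → ℝ} (hf : IntervalIntegrable f volume 0 1) :
      Tendsto (fun n => ∫ x in ε n..1, f x) atTop (𝓝 (∫ x in (0 : ℝ)..1, f x)) := by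
    have hf' : IntegrableOn f (uIcc 0 1) := by
      rwa [uIcc_of_le zero_le_one, ← intervalIntegrable_iff_integrableOn_Icc_of_le zero_le_one]
    refine (continuousOn_primitive_interval_left hf' 0 left_mem_uIcc).tendsto.comp
      (tendsto_nhdsWithin_iff.2 ⟨εlim, Eventually.of_forall fun n => ?_⟩)
    rw [uIcc_of_le zero_le_one]
    exact Ioc_subset_Icc_self (hε n)
  have energy_lim : Tendsto (fun n => ∫ x in ε n..1, a x * θ' x ^ 2) atTop
      (𝓝 (-∫ x in (0 : ℝ)..1, b' x * θ x)) := by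
    simpa [parts _ (hε _)] using bθlim.neg.sub (integral_lim hb'θ)
  have energy : IntegrableOn (fun x => a x * θ' x ^ 2) (Ioc 0 1) := by
    refine integrableOn_Ioc_of_intervalIntegral_norm_bounded_left
      (I := -(∫ x in (0 : ℝ)..1, b' x * θ x) + 1)
      (fun n => (intervalIntegrable_iff_integrableOn_Ioc_of_le (hε n).2).1
        (energy_int _ (hε n))) εlim ?_
    filter_upwards [energy_lim.eventually_le_const (lt_add_one _)] with n hn
    rw [integral_of_le (hε n).2] at hn
    refine le_of_eq_of_le (setIntegral_congr_fun measurableSet_Ioc fun x hx => ?_) hn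
    exact Real.norm_of_nonneg
      (mul_nonneg (hapos x ⟨(hε n).1.trans hx.1, hx.2⟩).le (sq_nonneg _))
  have hacont : ContinuousOn a (Ioc 0 1) := haC1.continuousOn.mono Ioc_subset_Icc_self
  have meas : AEStronglyMeasurable (fun x => √(a x) * θ' x) (volume.restrict (Ioc 0 1)) := by
    refine ContinuousOn.aestronglyMeasurable ?_ measurableSet_Ioc
    refine ContinuousOn.congr (f := fun x => √(a x) * (b x / a x)) (hacont.sqrt.mul
      ((hbcont.mono Ioc_subset_Icc_self).div hacont fun x hx => (hapos x hx).ne')) fun x hx => ?_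
    simp only [hb x hx, mul_div_cancel_left₀ _ (hapos x hx).ne']
  constructor
  · rw [memLp_two_iff_integrable_sq meas]
    refine energy.congr_fun (fun x hx => ?_) measurableSet_Ioc
    simp only [mul_pow, Real.sq_sqrt (hapos x hx).le]
  · have energy' := (intervalIntegrable_iff_integrableOn_Ioc_of_le zero_le_one).2 energy
    rw [tendsto_nhds_unique (integral_lim energy') energy_lim, neg_neg]
end

section
/- Let κ > 0. Let u, v : [0,1] → ℂ be absolutely continuous with u(0)=u(1)=v(0)=v(1)=0 and u', v' ∈ L²(0,1), and assume u' is absolutely continuous on [0,1]. Let θ : [0,1] → ℂ be absolutely continuous with θ(0)=θ(1)=0 and √a·θ' ∈ L²(0,1), and assume aθ' is absolutely continuous on [0,1] with (aθ')' ∈ L²(0,1) and u'' − κθ' ∈ L²(0,1). Then Re( ∫₀¹ v'(x) conj(u'(x)) dx + ∫₀¹ (u''(x) − κθ'(x)) conj(v(x)) dx + ∫₀¹ ((aθ')'(x) − κv'(x)) conj(θ(x)) dx ) = − ∫₀¹ a(x) |θ'(x)|² dx. -/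
open MeasureTheory Set intervalIntegral Filter Topology Complex

local notation "conj'" => (starRingEnd ℂ)

/-- The primitive of a complex-valued integrable function is absolutely continuous. -/
lemma absolutelyContinuousOnInterval_integral_complex {f : ℝ → ℂ} {a b : ℝ}
    (hf : IntervalIntegrable f volume a b) :
    AbsolutelyContinuousOnInterval (fun x => ∫ s in a..x, f s) a b := by
  have hconst (z : ℂ) : AbsolutelyContinuousOnInterval (fun _ : ℝ => z) a b :=
    ((LipschitzWith.const z).lipschitzOnWith).absolutelyContinuousOnInterval
  have hre : IntervalIntegrable (fun s => (f s).re) volume a b := ⟨hf.1.re, hf.2.re⟩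
  have him : IntervalIntegrable (fun s => (f s).im) volume a b := ⟨hf.1.im, hf.2.im⟩
  have key := ((hre.absolutelyContinuousOnInterval_intervalIntegral left_mem_uIcc).smul
    (hconst 1)).add ((him.absolutelyContinuousOnInterval_intervalIntegral left_mem_uIcc).smul
    (hconst I))
  have hsub {x : ℝ} (hx : x ∈ uIcc a b) : IntervalIntegrable f volume a x :=
    hf.mono_set (uIcc_subset_uIcc left_mem_uIcc hx)
  rw [absolutelyContinuousOnInterval_iff] at key ⊢
  intro ε hε
  obtain ⟨δ, hδ, h⟩ := key ε hε
  refine ⟨δ, hδ, fun E hE hlen => ?_⟩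
  have hval {x : ℝ} (hx : x ∈ uIcc a b) : ∫ s in a..x, f s =
      (∫ s in a..x, (f s).re) • (1 : ℂ) + (∫ s in a..x, (f s).im) • I := by
    have hr := intervalIntegral_re (𝕜 := ℂ) (hsub hx)
    have hi := intervalIntegral_im (𝕜 := ℂ) (hsub hx)
    simp only [RCLike.re_eq_complex_re, RCLike.im_eq_complex_im] at hr hi
    rw [hr, hi]
    simp
  refine lt_of_eq_of_lt (Finset.sum_congr rfl fun i hi => ?_) (h E hE hlen)
  have := hE.1 i hi
  rw [hval this.1, hval this.2]
  rfl

/-- Integration by parts for absolutely continuous complex-valued functions. -/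
lemma integral_mul_add_mul_eq_sub {F f G g : ℝ → ℂ} {a b : ℝ}
    (hf : IntervalIntegrable f volume a b) (hg : IntervalIntegrable g volume a b)
    (hF : ∀ x ∈ uIcc a b, F x = F a + ∫ s in a..x, f s)
    (hG : ∀ x ∈ uIcc a b, G x = G a + ∫ s in a..x, g s) :
    (∫ x in a..b, f x * G x) + (∫ x in a..b, F x * g x) = F b * G b - F a * G a := by
  have hconst (z : ℂ) : AbsolutelyContinuousOnInterval (fun _ : ℝ => z) a b :=
    ((LipschitzWith.const z).lipschitzOnWith).absolutelyContinuousOnInterval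
  set P : ℝ → ℂ := fun x => F a + ∫ s in a..x, f s with hP
  set Q : ℝ → ℂ := fun x => G a + ∫ s in a..x, g s with hQ
  have hPac : AbsolutelyContinuousOnInterval P a b :=
    (hconst _).add (absolutelyContinuousOnInterval_integral_complex hf)
  have hQac : AbsolutelyContinuousOnInterval Q a b :=
    (hconst _).add (absolutelyContinuousOnInterval_integral_complex hg)
  have hfQ : IntervalIntegrable (fun x => f x * Q x) volume a b :=
    hf.mul_continuousOn hQac.continuousOn
  have hPg : IntervalIntegrable (fun x => P x * g x) volume a b :=
    hg.continuousOn_mul hPac.continuousOn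
  have hR := hfQ.add hPg
  have hac := (hPac.smul hQac).sub (absolutelyContinuousOnInterval_integral_complex hR)
  have hzero : ∀ᵐ x, x ∈ uIcc a b → HasDerivAt
      (P • Q - fun x => ∫ s in a..x, (f s * Q s + P s * g s)) 0 x := by
    filter_upwards [hf.ae_hasDerivAt_integral, hg.ae_hasDerivAt_integral,
      hR.ae_hasDerivAt_integral] with x hx₁ hx₂ hx₃ hx
    have h₁ : HasDerivAt P (f x) x := (hx₁ hx a left_mem_uIcc).const_add _
    have h₂ : HasDerivAt Q (g x) x := (hx₂ hx a left_mem_uIcc).const_add _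
    have h := (h₁.mul h₂).sub (hx₃ hx a left_mem_uIcc)
    simp only [sub_self] at h
    exact h
  obtain ⟨C, hC⟩ := hac.const_of_ae_hasDerivAt_zero hzero
  have hb := (hC b right_mem_uIcc).trans (hC a left_mem_uIcc).symm
  simp only [Pi.sub_apply, smul_eq_mul, Pi.mul_apply, integral_same, sub_zero] at hb
  have e₁ : ∫ x in a..b, f x * G x = ∫ x in a..b, f x * Q x :=
    integral_congr fun x hx => by simp only [hG x hx, hQ]
  have e₂ : ∫ x in a..b, F x * g x = ∫ x in a..b, P x * g x :=
    integral_congr fun x hx => by simp only [hF x hx, hP]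
  have ePa : P a = F a := by simp [hP]
  have eQa : Q a = G a := by simp [hQ]
  rw [e₁, e₂, ← integral_add hfQ hPg, hF b right_mem_uIcc, hG b right_mem_uIcc]
  rw [ePa, eQa] at hb
  linear_combination -hb

/-- Sesquilinear integration by parts when the second function vanishes at both end points. -/
lemma integral_mul_conj_eq_neg {F f G g : ℝ → ℂ} {a b : ℝ}
    (hf : IntervalIntegrable f volume a b) (hg : IntervalIntegrable g volume a b)
    (hF : ∀ x ∈ uIcc a b, F x = F a + ∫ s in a..x, f s)
    (hG : ∀ x ∈ uIcc a b, G x = G a + ∫ s in a..x, g s) (hGa : G a = 0) (hGb : G b = 0) :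
    ∫ x in a..b, f x * conj' (G x) = -∫ x in a..b, F x * conj' (g x) := by
  have hgc : IntervalIntegrable (fun x => conj' (g x)) volume a b :=
    ⟨conjCLE.toContinuousLinearMap.integrable_comp hg.1,
      conjCLE.toContinuousLinearMap.integrable_comp hg.2⟩
  have h := integral_mul_add_mul_eq_sub (G := fun x => conj' (G x)) hf hgc hF
    (fun x hx => by rw [intervalIntegral_conj, hG x hx, map_add])
  simp only [hGa, hGb, map_zero, mul_zero, sub_zero] at h
  exact eq_neg_of_add_eq_zero_left h

/-- A primitive of an integrable function is continuous. -/
lemma continuousOn_of_eq_add_integral {F f : ℝ → ℂ} {a b : ℝ}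
    (hf : IntervalIntegrable f volume a b)
    (hF : ∀ x ∈ uIcc a b, F x = F a + ∫ s in a..x, f s) : ContinuousOn F (uIcc a b) :=
  ((absolutelyContinuousOnInterval_integral_complex hf).continuousOn.const_add _).congr hF

/-- (Weakly degenerate case.) Dissipativity identity:
`Re(∫₀¹ v' conj u' + ∫₀¹ (u'' − κθ') conj v + ∫₀¹ ((aθ')' − κv') conj θ) = −∫₀¹ a|θ'|²`. -/
theorem stmt_3 (a : ℝ → ℝ)
    (haC : ContinuousOn a (Icc (0:ℝ) 1))
    (haC1 : ContDiffOn ℝ 1 a (Ioc (0:ℝ) 1))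
    (ha0 : a 0 = 0)
    (hapos : ∀ x ∈ Ioc (0:ℝ) 1, 0 < a x)
    (haL1 : IntegrableOn (fun x => (a x)⁻¹) (Ioc (0:ℝ) 1) volume)
    (κ : ℝ) (hκ : 0 < κ)
    (u u' u'' v v' θ θ' b b' : ℝ → ℂ)
    -- u is absolutely continuous with u(0)=u(1)=0 and u' ∈ L²
    (hu'int : IntervalIntegrable u' volume 0 1)
    (huAC : ∀ x ∈ Icc (0:ℝ) 1, u x = u 0 + ∫ s in (0:ℝ)..x, u' s)
    (hu0 : u 0 = 0) (hu1 : u 1 = 0)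
    (hu'L2 : MemLp u' 2 (volume.restrict (Ioc (0:ℝ) 1)))
    -- u' is absolutely continuous with a.e. derivative u''
    (hu''int : IntervalIntegrable u'' volume 0 1)
    (hu'AC : ∀ x ∈ Icc (0:ℝ) 1, u' x = u' 0 + ∫ s in (0:ℝ)..x, u'' s)
    -- v is absolutely continuous with v(0)=v(1)=0 and v' ∈ L²
    (hv'int : IntervalIntegrable v' volume 0 1)
    (hvAC : ∀ x ∈ Icc (0:ℝ) 1, v x = v 0 + ∫ s in (0:ℝ)..x, v' s)
    (hv0 : v 0 = 0) (hv1 : v 1 = 0)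
    (hv'L2 : MemLp v' 2 (volume.restrict (Ioc (0:ℝ) 1)))
    -- θ is absolutely continuous with θ(0)=θ(1)=0 and √a·θ' ∈ L²
    (hθ'int : IntervalIntegrable θ' volume 0 1)
    (hθAC : ∀ x ∈ Icc (0:ℝ) 1, θ x = θ 0 + ∫ s in (0:ℝ)..x, θ' s)
    (hθ0 : θ 0 = 0) (hθ1 : θ 1 = 0)
    (hθ'L2 : MemLp (fun x => (Real.sqrt (a x) : ℂ) * θ' x) 2 (volume.restrict (Ioc (0:ℝ) 1)))
    -- b = aθ' is absolutely continuous on [0,1] with b' = (aθ')' ∈ L²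
    (hb : ∀ x ∈ Ioc (0:ℝ) 1, b x = (a x : ℂ) * θ' x)
    (hb'int : IntervalIntegrable b' volume 0 1)
    (hbAC : ∀ x ∈ Icc (0:ℝ) 1, b x = b 0 + ∫ s in (0:ℝ)..x, b' s)
    (hb'L2 : MemLp b' 2 (volume.restrict (Ioc (0:ℝ) 1)))
    -- u'' − κθ' ∈ L²
    (huθL2 : MemLp (fun x => u'' x - (κ : ℂ) * θ' x) 2 (volume.restrict (Ioc (0:ℝ) 1))) :
    ((∫ x in (0:ℝ)..1, v' x * conj' (u' x)) +
     (∫ x in (0:ℝ)..1, (u'' x - (κ : ℂ) * θ' x) * conj' (v x)) +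
     (∫ x in (0:ℝ)..1, (b' x - (κ : ℂ) * v' x) * conj' (θ x))).re
      = - ∫ x in (0:ℝ)..1, a x * ‖θ' x‖ ^ 2 := by
  rw [← uIcc_of_le (zero_le_one' ℝ)] at hu'AC hvAC hθAC hbAC
  have hcv : ContinuousOn (fun x => conj' (v x)) (uIcc 0 1) :=
    continuous_conj.comp_continuousOn (continuousOn_of_eq_add_integral hv'int hvAC)
  have hcθ : ContinuousOn (fun x => conj' (θ x)) (uIcc 0 1) :=
    continuous_conj.comp_continuousOn (continuousOn_of_eq_add_integral hθ'int hθAC)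
  have hswap (f g : ℝ → ℂ) :
      ∫ x in (0:ℝ)..1, f x * conj' (g x) = conj' (∫ x in (0:ℝ)..1, g x * conj' (f x)) := by
    rw [← intervalIntegral_conj]
    simp [mul_comm]
  have huv := integral_mul_conj_eq_neg hu''int hv'int hu'AC hvAC hv0 hv1
  have hθv := integral_mul_conj_eq_neg hθ'int hv'int hθAC hvAC hv0 hv1
  have hbθ := integral_mul_conj_eq_neg hb'int hθ'int hbAC hθAC hθ0 hθ1
  have hdiss : ∫ x in (0:ℝ)..1, b x * conj' (θ' x)
      = ((∫ x in (0:ℝ)..1, a x * ‖θ' x‖ ^ 2 : ℝ) : ℂ) := by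
    rw [← intervalIntegral.integral_ofReal]
    refine integral_congr_ae (ae_of_all _ fun x hx => ?_)
    rw [uIoc_of_le zero_le_one] at hx
    rw [hb x hx, mul_assoc, mul_conj']
    push_cast
    rfl
  have hsplit₁ : ∫ x in (0:ℝ)..1, (u'' x - (κ : ℂ) * θ' x) * conj' (v x)
      = (∫ x in (0:ℝ)..1, u'' x * conj' (v x))
        - (κ : ℂ) * ∫ x in (0:ℝ)..1, θ' x * conj' (v x) := by
    rw [← intervalIntegral.integral_const_mul, ← integral_sub (hu''int.mul_continuousOn hcv)
      ((hθ'int.mul_continuousOn hcv).const_mul _)]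
    simp only [sub_mul, mul_assoc]
  have hsplit₂ : ∫ x in (0:ℝ)..1, (b' x - (κ : ℂ) * v' x) * conj' (θ x)
      = (∫ x in (0:ℝ)..1, b' x * conj' (θ x))
        - (κ : ℂ) * ∫ x in (0:ℝ)..1, v' x * conj' (θ x) := by
    rw [← intervalIntegral.integral_const_mul, ← integral_sub (hb'int.mul_continuousOn hcθ)
      ((hv'int.mul_continuousOn hcθ).const_mul _)]
    simp only [sub_mul, mul_assoc]
  rw [hsplit₁, hsplit₂, huv, hθv, hbθ, hdiss, hswap u' v', hswap θ v']
  simp only [add_re, sub_re, neg_re, re_ofReal_mul, conj_re, ofReal_re]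
  ring
end

section
/- Let θ : (0,1] → ℂ be locally absolutely continuous with √a·θ' ∈ L²(0,1), and suppose aθ' extends to an absolutely continuous function on [0,1] with (aθ')' ∈ L²(0,1) and (aθ')(0) = 0. Let θ̃ ∈ L²(0,1;ℂ) be locally absolutely continuous on (0,1] with √a·θ̃' ∈ L²(0,1) and θ̃(1) = 0. Then a(x) θ'(x) θ̃(x) → 0 as x → 0⁺. -/
open MeasureTheory Set intervalIntegral Filter Topology

/-- The primitive of a complex-valued interval integrable function is absolutely continuous. -/
lemma IntervalIntegrable.absolutelyContinuousOnInterval_intervalIntegral_complex {f : ℝ → ℂ}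
    {u v c : ℝ} (h : IntervalIntegrable f volume u v) (hc : c ∈ uIcc u v) :
    AbsolutelyContinuousOnInterval (fun x ↦ ∫ t in c..x, f t) u v := by
  have hre : IntervalIntegrable (fun t ↦ (f t).re) volume u v := ⟨h.1.re, h.2.re⟩
  have him : IntervalIntegrable (fun t ↦ (f t).im) volume u v := ⟨h.1.im, h.2.im⟩
  have const_ac (z : ℂ) : AbsolutelyContinuousOnInterval (fun _ ↦ z) u v :=
    contDiffOn_const.absolutelyContinuousOnInterval
  have hsum := ((hre.absolutelyContinuousOnInterval_intervalIntegral hc).fun_smul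
    (const_ac 1)).fun_add
    ((him.absolutelyContinuousOnInterval_intervalIntegral hc).fun_smul (const_ac Complex.I))
  have heq (x : ℝ) (hx : x ∈ uIcc u v) : (∫ t in c..x, (f t).re) • (1 : ℂ) +
      (∫ t in c..x, (f t).im) • Complex.I = ∫ t in c..x, f t := by
    have hcx : IntervalIntegrable f volume c x := h.mono_set (uIcc_subset_uIcc hc hx)
    have hre_eq : (∫ t in c..x, f t).re = ∫ t in c..x, (f t).re :=
      (Complex.reCLM.intervalIntegral_comp_comm hcx).symm
    have him_eq : (∫ t in c..x, f t).im = ∫ t in c..x, (f t).im :=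
      (Complex.imCLM.intervalIntegral_comp_comm hcx).symm
    rw [← hre_eq, ← him_eq]
    simp [Complex.re_add_im]
  refine Tendsto.congr' ?_ hsum
  filter_upwards [mem_inf_of_right (mem_principal_self _)] with E hE
  exact Finset.sum_congr rfl fun i hi ↦ by
    rw [heq _ (hE.1 i hi).1, heq _ (hE.1 i hi).2]

/-- Product rule, in integrated form, for primitives of complex-valued integrable functions. -/
lemma intervalIntegral_mul_add_mul_of_primitive {f g F G : ℝ → ℂ} {u v : ℝ}
    (hf : IntervalIntegrable f volume u v) (hg : IntervalIntegrable g volume u v)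
    (hF : ∀ x ∈ uIcc u v, F x = F u + ∫ t in u..x, f t)
    (hG : ∀ x ∈ uIcc u v, G x = G u + ∫ t in u..x, g t) :
    ∫ t in u..v, (f t * G t + F t * g t) = F v * G v - F u * G u := by
  set P : ℝ → ℂ := fun x ↦ F u + ∫ t in u..x, f t with hP
  set Q : ℝ → ℂ := fun x ↦ G u + ∫ t in u..x, g t with hQ
  have const_ac (z : ℂ) : AbsolutelyContinuousOnInterval (fun _ ↦ z) u v :=
    contDiffOn_const.absolutelyContinuousOnInterval
  have hPac : AbsolutelyContinuousOnInterval P u v := (const_ac _).fun_add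
    (hf.absolutelyContinuousOnInterval_intervalIntegral_complex left_mem_uIcc)
  have hQac : AbsolutelyContinuousOnInterval Q u v := (const_ac _).fun_add
    (hg.absolutelyContinuousOnInterval_intervalIntegral_complex left_mem_uIcc)
  have hint : IntervalIntegrable (fun t ↦ f t * Q t + P t * g t) volume u v :=
    (hf.mul_continuousOn hQac.continuousOn).add (hg.continuousOn_mul hPac.continuousOn)
  have hac := (hPac.fun_smul hQac).fun_sub
    (hint.absolutelyContinuousOnInterval_intervalIntegral_complex left_mem_uIcc)
  obtain ⟨C, hC⟩ := hac.const_of_ae_hasDerivAt_zero <| by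
    filter_upwards [hf.ae_hasDerivAt_integral, hg.ae_hasDerivAt_integral,
      hint.ae_hasDerivAt_integral] with x hfx hgx hx hmem
    have hPx : HasDerivAt P (f x) x := (hfx hmem u left_mem_uIcc).const_add _
    have hQx : HasDerivAt Q (g x) x := (hgx hmem u left_mem_uIcc).const_add _
    simpa only [sub_self, smul_eq_mul] using (hPx.fun_mul hQx).fun_sub (hx hmem u left_mem_uIcc)
  have hu := hC u left_mem_uIcc
  have hv := hC v right_mem_uIcc
  rw [integral_congr (g := fun t ↦ f t * Q t + P t * g t)
    fun t ht ↦ by simp only [hP, hQ, ← hF t ht, ← hG t ht],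
    hF v right_mem_uIcc, hG v right_mem_uIcc]
  simp only [integral_same, sub_zero, smul_eq_mul] at hu hv
  have hPu : P u = F u := by simp [hP]
  have hQu : Q u = G u := by simp [hQ]
  rw [hPu, hQu] at hu
  change _ = P v * Q v - _
  rw [hu, ← hv]
  ring

/-- The primitive of an `L²` function vanishing at `0` is `O(√x)`. -/
lemma norm_intervalIntegral_le_sqrt_mul {f : ℝ → ℂ}
    (hf : MemLp f 2 (volume.restrict (Ioc (0 : ℝ) 1))) {x : ℝ} (hx : x ∈ Ioc (0 : ℝ) 1) :
    ‖∫ t in (0 : ℝ)..x, f t‖ ≤ √(∫ t in Ioc (0 : ℝ) 1, ‖f t‖ ^ 2) * √x := by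
  have hsub : Ioc 0 x ⊆ Ioc (0 : ℝ) 1 := Ioc_subset_Ioc_right hx.2
  have hfx : MemLp f 2 (volume.restrict (Ioc 0 x)) :=
    hf.mono_measure (Measure.restrict_mono hsub le_rfl)
  have hcs := integral_mul_norm_le_Lp_mul_Lq (μ := volume.restrict (Ioc 0 x))
    Real.HolderConjugate.two_two (f := f) (g := fun _ ↦ (1 : ℂ))
    (by simpa using hfx) (memLp_const 1)
  simp only [norm_one, mul_one, Real.rpow_ofNat, one_pow, ← Real.sqrt_eq_rpow] at hcs
  have hone : ∫ _ in Ioc 0 x, (1 : ℝ) = x := by simp [hx.1.le]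
  rw [hone] at hcs
  calc ‖∫ t in (0 : ℝ)..x, f t‖ ≤ ∫ t in Ioc 0 x, ‖f t‖ := by
        rw [integral_of_le hx.1.le]
        exact norm_integral_le_integral_norm _
    _ ≤ √(∫ t in Ioc 0 x, ‖f t‖ ^ 2) * √x := hcs
    _ ≤ √(∫ t in Ioc (0 : ℝ) 1, ‖f t‖ ^ 2) * √x := by
        refine mul_le_mul_of_nonneg_right (Real.sqrt_le_sqrt ?_) (Real.sqrt_nonneg x)
        exact setIntegral_mono_set ((memLp_two_iff_integrable_sq_norm hf.1).1 hf)
          (ae_of_all _ fun t ↦ by positivity) hsub.eventuallyLE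

/-- A function at least of the order of `1 / x` at `0⁺` is not integrable on `(0, 1]`. -/
lemma not_integrableOn_Ioc_of_inv_isBigO {f : ℝ → ℝ}
    (hf : (fun x : ℝ ↦ x⁻¹) =O[𝓝[>] 0] f) : ¬ IntegrableOn f (Ioc (0 : ℝ) 1) := by
  refine not_integrableOn_of_tendsto_norm_atTop_of_deriv_isBigO_filter (f := Real.log) (𝓝[>] 0)
    (Ioc_mem_nhdsGT one_pos) ?_ ?_ (by simpa [Real.deriv_log'] using hf)
  · filter_upwards [self_mem_nhdsWithin] with x hx
    exact Real.differentiableAt_log (ne_of_gt hx)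
  · exact tendsto_abs_atBot_atTop.comp Real.tendsto_log_nhdsGT_zero

/-- (Strongly degenerate case.) Boundary trace vanishing:
`a(x) θ'(x) θ̃(x) → 0` as `x → 0⁺`. -/
theorem stmt_4 (a : ℝ → ℝ)
    (haC1 : ContDiffOn ℝ 1 a (Icc (0:ℝ) 1))
    (ha0 : a 0 = 0)
    (hapos : ∀ x ∈ Ioc (0:ℝ) 1, 0 < a x)
    (hanotL1 : ¬ IntegrableOn (fun x => (a x)⁻¹) (Ioc (0:ℝ) 1) volume)
    (hasqrtL1 : IntegrableOn (fun x => (Real.sqrt (a x))⁻¹) (Ioc (0:ℝ) 1) volume)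
    (θ θ' θt θt' : ℝ → ℂ)
    -- θ locally absolutely continuous on (0,1] with √a·θ' ∈ L²
    (hθ'locint : ∀ ε ∈ Ioc (0:ℝ) 1, IntervalIntegrable θ' volume ε 1)
    (hθlocAC : ∀ x ∈ Ioc (0:ℝ) 1, θ x = θ 1 - ∫ s in x..(1:ℝ), θ' s)
    (hθ'L2 : MemLp (fun x => (Real.sqrt (a x) : ℂ) * θ' x) 2 (volume.restrict (Ioc (0:ℝ) 1)))
    -- aθ' extends to an absolutely continuous function b on [0,1] with b' ∈ L² and b 0 = 0
    (b b' : ℝ → ℂ)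
    (hb : ∀ x ∈ Ioc (0:ℝ) 1, b x = (a x : ℂ) * θ' x)
    (hb'int : IntervalIntegrable b' volume 0 1)
    (hbAC : ∀ x ∈ Icc (0:ℝ) 1, b x = b 0 + ∫ s in (0:ℝ)..x, b' s)
    (hb'L2 : MemLp b' 2 (volume.restrict (Ioc (0:ℝ) 1)))
    (hb0 : b 0 = 0)
    -- θ̃ ∈ L²(0,1), locally absolutely continuous on (0,1], √a·θ̃' ∈ L², θ̃(1) = 0
    (hθtL2 : MemLp θt 2 (volume.restrict (Ioc (0:ℝ) 1)))
    (hθt'locint : ∀ ε ∈ Ioc (0:ℝ) 1, IntervalIntegrable θt' volume ε 1)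
    (hθtlocAC : ∀ x ∈ Ioc (0:ℝ) 1, θt x = θt 1 - ∫ s in x..(1:ℝ), θt' s)
    (hθt'L2 : MemLp (fun x => (Real.sqrt (a x) : ℂ) * θt' x) 2 (volume.restrict (Ioc (0:ℝ) 1)))
    (hθt1 : θt 1 = 0) :
    Tendsto (fun x => (a x : ℂ) * θ' x * θt x) (nhdsWithin 0 (Ioi (0:ℝ))) (nhds 0) := by
  set h : ℝ → ℂ := fun t ↦ b' t * θt t + b t * θt' t with hh
  have hint : IntegrableOn h (Ioc 0 1) := by
    refine (hb'L2.integrable_mul hθtL2).add <| (hθ'L2.integrable_mul hθt'L2).congr ?_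
    filter_upwards [ae_restrict_mem measurableSet_Ioc] with t ht
    have hsq : (√(a t) : ℂ) * √(a t) = a t := by
      rw [← Complex.ofReal_mul, Real.mul_self_sqrt (hapos t ht).le]
    simp only [Pi.mul_apply, hb t ht, ← hsq]
    ring
  have hprod (x : ℝ) (hx : x ∈ Ioc (0 : ℝ) 1) : b x * θt x = - ∫ t in x..1, h t := by
    have hb'x : IntervalIntegrable b' volume x 1 :=
      hb'int.mono_set (uIcc_subset_uIcc (by simp [hx.1.le, hx.2]) right_mem_uIcc)
    rw [hh, intervalIntegral_mul_add_mul_of_primitive hb'x (hθt'locint x hx), hθt1]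
    · ring
    · intro y hy
      rw [uIcc_of_le hx.2] at hy
      have hy0 : 0 ≤ y := hx.1.le.trans hy.1
      rw [hbAC y ⟨hy0, hy.2⟩, hbAC x ⟨hx.1.le, hx.2⟩, add_assoc,
        integral_add_adjacent_intervals]
      · exact hb'int.mono_set (uIcc_subset_uIcc left_mem_uIcc (by simp [hx.1.le, hx.2]))
      · exact hb'x.mono_set (uIcc_subset_uIcc left_mem_uIcc (by simp [hy.1, hy.2, hx.2]))
    · intro y hy
      have hi := hθt'locint x hx
      have hadd := integral_add_adjacent_intervals
        (hi.mono_set (uIcc_subset_uIcc left_mem_uIcc hy))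
        (hi.mono_set (uIcc_subset_uIcc hy right_mem_uIcc))
      rw [uIcc_of_le hx.2] at hy
      rw [hθtlocAC y ⟨hx.1.trans_le hy.1, hy.2⟩, hθtlocAC x hx, ← hadd]
      ring
  have hIoc : ∀ᶠ x in 𝓝[>] (0 : ℝ), x ∈ Ioc (0 : ℝ) 1 := Ioc_mem_nhdsGT one_pos
  set L : ℂ := - ∫ t in (0 : ℝ)..1, h t with hL
  have hlim : Tendsto (fun x ↦ b x * θt x) (𝓝[>] 0) (𝓝 L) := by
    have hcont : ContinuousOn (fun x ↦ ∫ t in x..1, h t) (uIcc 0 1) :=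
      continuousOn_primitive_interval_left (by
        rwa [uIcc_of_le zero_le_one, integrableOn_Icc_iff_integrableOn_Ioc])
    have hmono : 𝓝[>] (0 : ℝ) ≤ 𝓝[uIcc 0 1] 0 := by
      rw [uIcc_of_le zero_le_one]
      exact nhdsWithin_le_of_mem (Icc_mem_nhdsGT one_pos)
    refine ((hcont 0 left_mem_uIcc).neg.mono_left hmono).congr' ?_
    filter_upwards [hIoc] with x hx using (hprod x hx).symm
  have hL0 : L = 0 := by
    by_contra hne
    have hpos : 0 < ‖L‖ / 2 := by positivity
    set C := √(∫ t in Ioc (0 : ℝ) 1, ‖b' t‖ ^ 2)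
    refine not_integrableOn_Ioc_of_inv_isBigO (f := fun x ↦ ‖θt x‖ ^ 2) ?_
      ((memLp_two_iff_integrable_sq_norm hθtL2.1).1 hθtL2)
    refine Asymptotics.IsBigO.of_bound (C ^ 2 / (‖L‖ / 2) ^ 2) ?_
    filter_upwards [hIoc, hlim.norm.eventually_const_lt (half_lt_self (norm_pos_iff.2 hne))]
      with x hx hlt
    have hbx : ‖b x‖ ≤ C * √x := by
      rw [hbAC x ⟨hx.1.le, hx.2⟩, hb0, zero_add]
      exact norm_intervalIntegral_le_sqrt_mul hb'L2 hx
    have hle : ‖L‖ / 2 ≤ C * √x * ‖θt x‖ := by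
      refine hlt.le.trans ?_
      rw [norm_mul]
      gcongr
    have hsq : (‖L‖ / 2) ^ 2 ≤ C ^ 2 * x * ‖θt x‖ ^ 2 := by
      calc (‖L‖ / 2) ^ 2 ≤ (C * √x * ‖θt x‖) ^ 2 := by gcongr
        _ = C ^ 2 * x * ‖θt x‖ ^ 2 := by rw [mul_pow, mul_pow, Real.sq_sqrt hx.1.le]
    rw [Real.norm_of_nonneg (inv_nonneg.2 hx.1.le), Real.norm_of_nonneg (by positivity),
      div_mul_eq_mul_div, le_div_iff₀ (by positivity), inv_mul_le_iff₀ hx.1]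
    linarith
  rw [hL0] at hlim
  refine hlim.congr' ?_
  filter_upwards [hIoc] with x hx
  rw [hb x hx]
end

section
/- Let κ > 0 and λ ∈ ℝ. Let u, v : [0,1] → ℂ be absolutely continuous with u(0)=u(1)=v(0)=v(1)=0 and u', v' ∈ L²(0,1), with u' absolutely continuous; let θ : [0,1] → ℂ be absolutely continuous with θ(0)=θ(1)=0, √a·θ' ∈ L²(0,1), and aθ' absolutely continuous on [0,1] with (aθ')' ∈ L²(0,1). If v = iλu on [0,1], u'' − κθ' = iλv a.e. on (0,1), and (aθ')' − κv' = iλθ a.e. on (0,1), then u, v and θ vanish identically on [0,1]. -/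
open MeasureTheory Set intervalIntegral Filter Topology

/-- A function on `[0,1]` that is the primitive of an interval integrable function is continuous. -/
theorem continuousOn_of_eq_add_integral_s6 {E : Type*} [NormedAddCommGroup E] [NormedSpace ℝ E]
    {f f' : ℝ → E}
    (hf' : IntervalIntegrable f' volume 0 1)
    (hf : ∀ x ∈ Icc (0:ℝ) 1, f x = f 0 + ∫ s in (0:ℝ)..x, f' s) :
    ContinuousOn f (uIcc (0:ℝ) 1) := by
  have h := intervalIntegral.continuousOn_primitive_interval' hf' (left_mem_uIcc)
  refine (continuousOn_const.add h).congr fun x hx => hf x ?_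
  rwa [uIcc_of_le zero_le_one] at hx

/-- Integration by parts for real functions given as primitives. -/
theorem integral_deriv_mul_add_mul_deriv_of_eq_add_integral {f f' g g' : ℝ → ℝ}
    (hf' : IntervalIntegrable f' volume 0 1)
    (hf : ∀ x ∈ Icc (0:ℝ) 1, f x = f 0 + ∫ s in (0:ℝ)..x, f' s)
    (hg' : IntervalIntegrable g' volume 0 1)
    (hg : ∀ x ∈ Icc (0:ℝ) 1, g x = g 0 + ∫ s in (0:ℝ)..x, g' s) :
    ∫ x in (0:ℝ)..1, (f' x * g x + f x * g' x) = f 1 * g 1 - f 0 * g 0 := by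
  have key : ∀ {h h' : ℝ → ℝ}, IntervalIntegrable h' volume 0 1 →
      AbsolutelyContinuousOnInterval (fun x => h 0 + ∫ s in (0:ℝ)..x, h' s) 0 1 ∧
      ∀ᵐ x, x ∈ uIcc (0:ℝ) 1 → deriv (fun x => h 0 + ∫ s in (0:ℝ)..x, h' s) x = h' x := by
    intro h h' hh'
    refine ⟨?_, ?_⟩
    · have hc : AbsolutelyContinuousOnInterval (fun _ : ℝ => h 0) 0 1 :=
        ((LipschitzWith.const (h 0)).lipschitzOnWith).absolutelyContinuousOnInterval
      exact hc.add (hh'.absolutelyContinuousOnInterval_intervalIntegral left_mem_uIcc)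
    · filter_upwards [hh'.ae_hasDerivAt_integral] with x hx hmem
      exact ((hx hmem 0 left_mem_uIcc).const_add (h 0)).deriv
  obtain ⟨hfa, hfd⟩ := key (h := f) hf'
  obtain ⟨hga, hgd⟩ := key (h := g) hg'
  have h := hfa.integral_deriv_mul_eq_sub hga
  simp only [← hf 1 (by simp), ← hg 1 (by simp), integral_same, add_zero] at h
  rw [← h]
  refine intervalIntegral.integral_congr_ae ?_
  filter_upwards [hfd, hgd] with x hx hx' hmem
  have hmem' := uIoc_subset_uIcc hmem
  rw [hx hmem', hx' hmem']
  rw [uIcc_of_le zero_le_one] at hmem'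
  rw [← hf x hmem', ← hg x hmem']

/-- Integration by parts for complex functions given as primitives, with respect to the real
inner product `Re (f * conj g)`. -/
theorem integral_re_parts_of_eq_add_integral {f f' g g' : ℝ → ℂ}
    (hf' : IntervalIntegrable f' volume 0 1)
    (hf : ∀ x ∈ Icc (0:ℝ) 1, f x = f 0 + ∫ s in (0:ℝ)..x, f' s)
    (hg' : IntervalIntegrable g' volume 0 1)
    (hg : ∀ x ∈ Icc (0:ℝ) 1, g x = g 0 + ∫ s in (0:ℝ)..x, g' s)
    (hf0 : f 0 = 0 ∨ g 0 = 0) (hf1 : f 1 = 0 ∨ g 1 = 0) :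
    IntervalIntegrable (fun x => ((f' x).re * (g x).re + (f x).re * (g' x).re) +
      ((f' x).im * (g x).im + (f x).im * (g' x).im)) volume 0 1 ∧
    ∫ x in (0:ℝ)..1, (((f' x).re * (g x).re + (f x).re * (g' x).re) +
      ((f' x).im * (g x).im + (f x).im * (g' x).im)) = 0 := by
  have hre : ∀ {h : ℝ → ℂ}, IntervalIntegrable h volume 0 1 →
      IntervalIntegrable (fun x => (h x).re) volume 0 1 := fun h =>
    ⟨h.1.re, h.2.re⟩
  have him : ∀ {h : ℝ → ℂ}, IntervalIntegrable h volume 0 1 →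
      IntervalIntegrable (fun x => (h x).im) volume 0 1 := fun h =>
    ⟨h.1.im, h.2.im⟩
  have part : ∀ {h h' : ℝ → ℂ} (L : ℂ →L[ℝ] ℝ), IntervalIntegrable h' volume 0 1 →
      (∀ x ∈ Icc (0:ℝ) 1, h x = h 0 + ∫ s in (0:ℝ)..x, h' s) →
      ∀ x ∈ Icc (0:ℝ) 1, L (h x) = L (h 0) + ∫ s in (0:ℝ)..x, L (h' s) := by
    intro h h' L hh' hh x hx
    rw [L.intervalIntegral_comp_comm (hh'.mono_set ?_), ← map_add, ← hh x hx]
    rw [uIcc_of_le hx.1, uIcc_of_le zero_le_one]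
    exact Icc_subset_Icc_right hx.2
  have cf := continuousOn_of_eq_add_integral_s6 hf' hf
  have cg := continuousOn_of_eq_add_integral_s6 hg' hg
  have i1 := ((hre hf').mul_continuousOn (Complex.continuous_re.comp_continuousOn cg)).add
    ((hre hg').continuousOn_mul (Complex.continuous_re.comp_continuousOn cf))
  have i2 := ((him hf').mul_continuousOn (Complex.continuous_im.comp_continuousOn cg)).add
    ((him hg').continuousOn_mul (Complex.continuous_im.comp_continuousOn cf))
  have e1 := integral_deriv_mul_add_mul_deriv_of_eq_add_integral (hre hf')
    (part Complex.reCLM hf' hf) (hre hg') (part Complex.reCLM hg' hg)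
  have e2 := integral_deriv_mul_add_mul_deriv_of_eq_add_integral (him hf')
    (part Complex.imCLM hf' hf) (him hg') (part Complex.imCLM hg' hg)
  refine ⟨i1.add i2, ?_⟩
  refine (intervalIntegral.integral_add i1 i2).trans ((congrArg₂ (· + ·) e1 e2).trans ?_)
  rcases hf0 with h | h <;> rcases hf1 with h' | h' <;> simp [h, h']

/-- A primitive of a function vanishing a.e. on `(0,1)` is constant on `[0,1]`. -/
theorem eq_of_eq_add_integral_of_ae_eq_zero {f f' : ℝ → ℂ}
    (hf : ∀ x ∈ Icc (0:ℝ) 1, f x = f 0 + ∫ s in (0:ℝ)..x, f' s)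
    (h0 : ∀ᵐ x, x ∈ Ioo (0:ℝ) 1 → f' x = 0) :
    ∀ x ∈ Icc (0:ℝ) 1, f x = f 0 := by
  intro x hx
  rw [hf x hx, intervalIntegral.integral_zero_ae, add_zero]
  filter_upwards [h0, Measure.ae_ne volume (1:ℝ)] with s hs hs1 hmem
  rw [uIoc_of_le hx.1] at hmem
  exact hs ⟨hmem.1, lt_of_le_of_ne (hmem.2.trans hx.2) hs1⟩

/-- (Weakly degenerate case.) No purely imaginary eigenvalues:
if `v = iλu`, `u'' − κθ' = iλv` and `(aθ')' − κv' = iλθ`, then `u = v = θ = 0` on `[0,1]`. -/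
theorem stmt_6 (a : ℝ → ℝ)
    (haC : ContinuousOn a (Icc (0:ℝ) 1))
    (haC1 : ContDiffOn ℝ 1 a (Ioc (0:ℝ) 1))
    (ha0 : a 0 = 0)
    (hapos : ∀ x ∈ Ioc (0:ℝ) 1, 0 < a x)
    (haL1 : IntegrableOn (fun x => (a x)⁻¹) (Ioc (0:ℝ) 1) volume)
    (κ : ℝ) (hκ : 0 < κ) (lam : ℝ)
    (u u' u'' v v' θ θ' b b' : ℝ → ℂ)
    (hu'int : IntervalIntegrable u' volume 0 1)
    (huAC : ∀ x ∈ Icc (0:ℝ) 1, u x = u 0 + ∫ s in (0:ℝ)..x, u' s)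
    (hu0 : u 0 = 0) (hu1 : u 1 = 0)
    (hu'L2 : MemLp u' 2 (volume.restrict (Ioc (0:ℝ) 1)))
    (hu''int : IntervalIntegrable u'' volume 0 1)
    (hu'AC : ∀ x ∈ Icc (0:ℝ) 1, u' x = u' 0 + ∫ s in (0:ℝ)..x, u'' s)
    (hv'int : IntervalIntegrable v' volume 0 1)
    (hvAC : ∀ x ∈ Icc (0:ℝ) 1, v x = v 0 + ∫ s in (0:ℝ)..x, v' s)
    (hv0 : v 0 = 0) (hv1 : v 1 = 0)
    (hv'L2 : MemLp v' 2 (volume.restrict (Ioc (0:ℝ) 1)))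
    (hθ'int : IntervalIntegrable θ' volume 0 1)
    (hθAC : ∀ x ∈ Icc (0:ℝ) 1, θ x = θ 0 + ∫ s in (0:ℝ)..x, θ' s)
    (hθ0 : θ 0 = 0) (hθ1 : θ 1 = 0)
    (hθ'L2 : MemLp (fun x => (Real.sqrt (a x) : ℂ) * θ' x) 2 (volume.restrict (Ioc (0:ℝ) 1)))
    (hb : ∀ x ∈ Ioc (0:ℝ) 1, b x = (a x : ℂ) * θ' x)
    (hb'int : IntervalIntegrable b' volume 0 1)
    (hbAC : ∀ x ∈ Icc (0:ℝ) 1, b x = b 0 + ∫ s in (0:ℝ)..x, b' s)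
    (hb'L2 : MemLp b' 2 (volume.restrict (Ioc (0:ℝ) 1)))
    -- the eigenvalue system
    (heq1 : ∀ x ∈ Icc (0:ℝ) 1, v x = Complex.I * lam * u x)
    (heq2 : ∀ᵐ x ∂volume, x ∈ Ioo (0:ℝ) 1 →
      u'' x - (κ : ℂ) * θ' x = Complex.I * lam * v x)
    (heq3 : ∀ᵐ x ∂volume, x ∈ Ioo (0:ℝ) 1 →
      b' x - (κ : ℂ) * v' x = Complex.I * lam * θ x) :
    ∀ x ∈ Icc (0:ℝ) 1, u x = 0 ∧ v x = 0 ∧ θ x = 0 := by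
  have ne1 : ∀ᵐ x : ℝ ∂volume, x ≠ 1 := Measure.ae_ne volume 1
  have cv : IntervalIntegrable (fun x => Complex.I * lam * u' x) volume 0 1 :=
    hu'int.const_mul _
  have hvAC' : ∀ x ∈ Icc (0:ℝ) 1, v x = v 0 + ∫ s in (0:ℝ)..x, Complex.I * lam * u' s := by
    intro x hx
    rw [intervalIntegral.integral_const_mul, hv0, zero_add, heq1 x hx, huAC x hx, hu0, zero_add]
  obtain ⟨i1, e1⟩ := integral_re_parts_of_eq_add_integral hb'int hbAC hθ'int hθAC
    (Or.inr hθ0) (Or.inr hθ1)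
  obtain ⟨i2, e2⟩ := integral_re_parts_of_eq_add_integral hv'int hvAC hθ'int hθAC
    (Or.inr hθ0) (Or.inr hθ1)
  obtain ⟨i3, e3⟩ := integral_re_parts_of_eq_add_integral cv hvAC' hu''int hu'AC
    (Or.inl hv0) (Or.inl hv1)
  have hsum := intervalIntegral.integral_add (i1.sub (i2.const_mul κ)) i3
  have hsub := intervalIntegral.integral_sub i1 (i2.const_mul κ)
  rw [intervalIntegral.integral_const_mul, e1, e2, mul_zero, sub_zero] at hsub
  rw [e3, hsub, add_zero] at hsum
  have hint := (i1.sub (i2.const_mul κ)).add i3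
  -- the dissipation identity `Re (b * conj θ') = a * |θ'|²`
  have hae : ∀ᵐ x ∂volume.restrict (Ioc (0:ℝ) 1),
      (((b' x).re * (θ x).re + (b x).re * (θ' x).re) +
        ((b' x).im * (θ x).im + (b x).im * (θ' x).im)) -
      κ * (((v' x).re * (θ x).re + (v x).re * (θ' x).re) +
        ((v' x).im * (θ x).im + (v x).im * (θ' x).im)) +
      (((Complex.I * lam * u' x).re * (u' x).re + (v x).re * (u'' x).re) +
        ((Complex.I * lam * u' x).im * (u' x).im + (v x).im * (u'' x).im)) =
      a x * Complex.normSq (θ' x) := by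
    rw [ae_restrict_iff' measurableSet_Ioc]
    filter_upwards [heq2, heq3, ne1] with x h2 h3 hx1 hx
    have hx' : x ∈ Ioo (0:ℝ) 1 := ⟨hx.1, lt_of_le_of_ne hx.2 hx1⟩
    have h2 := h2 hx'
    have h3 := h3 hx'
    have hu2r := congrArg Complex.re h2
    have hu2i := congrArg Complex.im h2
    have hb2r := congrArg Complex.re h3
    have hb2i := congrArg Complex.im h3
    simp at hu2r hu2i hb2r hb2i
    rw [hb x hx, Complex.normSq_apply]
    simp
    linear_combination (θ x).re * hb2r + (θ x).im * hb2i + (v x).re * hu2r + (v x).im * hu2i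
  have hnn : 0 ≤ᵐ[volume.restrict (Ioc (0:ℝ) 1)] fun x => a x * Complex.normSq (θ' x) := by
    rw [EventuallyLE, ae_restrict_iff' measurableSet_Ioc]
    exact Eventually.of_forall fun x hx => mul_nonneg (hapos x hx).le (Complex.normSq_nonneg _)
  have hzero : ∫ x in Ioc (0:ℝ) 1, a x * Complex.normSq (θ' x) = 0 := by
    rw [← integral_congr_ae hae, ← intervalIntegral.integral_of_le zero_le_one]
    exact hsum
  have hθ'0 : ∀ᵐ x, x ∈ Ioc (0:ℝ) 1 → θ' x = 0 := by
    have h := (integral_eq_zero_iff_of_nonneg_ae hnn (hint.1.congr hae)).1 hzero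
    rw [EventuallyEq, ae_restrict_iff' measurableSet_Ioc] at h
    filter_upwards [h] with x hx hmem
    simpa [(hapos x hmem).ne'] using hx hmem
  have hθz : ∀ x ∈ Icc (0:ℝ) 1, θ x = 0 := fun x hx =>
    (eq_of_eq_add_integral_of_ae_eq_zero hθAC
      (hθ'0.mono fun s hs hmem => hs (Ioo_subset_Ioc_self hmem)) x hx).trans hθ0
  have hbz : ∀ x ∈ Icc (0:ℝ) 1, b x = 0 := by
    have cb := continuousOn_of_eq_add_integral_s6 hb'int hbAC
    rw [uIcc_of_le zero_le_one] at cb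
    refine Measure.eqOn_Icc_of_ae_eq volume zero_ne_one ?_ cb continuousOn_const
    rw [← restrict_Ioc_eq_restrict_Icc, EventuallyEq, ae_restrict_iff' measurableSet_Ioc]
    filter_upwards [hθ'0] with x hx hmem
    rw [hb x hmem, hx hmem, mul_zero]
  have hvz : ∀ x ∈ Icc (0:ℝ) 1, v x = 0 := by
    intro x hx
    have h : ∫ s in (0:ℝ)..x, b' s = κ * v x := by
      rw [hvAC x hx, hv0, zero_add, ← intervalIntegral.integral_const_mul]
      refine intervalIntegral.integral_congr_ae ?_
      filter_upwards [heq3, ne1] with s h3 hs1 hmem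
      rw [uIoc_of_le hx.1] at hmem
      have hs : s ∈ Ioo (0:ℝ) 1 := ⟨hmem.1, lt_of_le_of_ne (hmem.2.trans hx.2) hs1⟩
      have h3 := h3 hs
      rw [hθz s (Ioo_subset_Icc_self hs), mul_zero] at h3
      exact sub_eq_zero.1 h3
    have hbx := hbAC x hx
    rw [hbz x hx, hbz 0 (by simp), h, zero_add] at hbx
    simpa [hκ.ne'] using hbx.symm
  have hu'c : ∀ x ∈ Icc (0:ℝ) 1, u' x = u' 0 := by
    refine eq_of_eq_add_integral_of_ae_eq_zero hu'AC ?_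
    filter_upwards [heq2, hθ'0] with s h2 hθs hs
    simpa [hθs (Ioo_subset_Ioc_self hs), hvz s (Ioo_subset_Icc_self hs)] using h2 hs
  have hulin : ∀ x ∈ Icc (0:ℝ) 1, u x = x * u' 0 := by
    intro x hx
    rw [huAC x hx, hu0, zero_add, intervalIntegral.integral_congr (g := fun _ => u' 0)]
    · simp
    · intro s hs
      rw [uIcc_of_le hx.1] at hs
      exact hu'c s ⟨hs.1, hs.2.trans hx.2⟩
  have hu'0 : u' 0 = 0 := by
    simpa [hu1] using (hulin 1 (by simp)).symm
  exact fun x hx => ⟨by rw [hulin x hx, hu'0, mul_zero], hvz x hx, hθz x hx⟩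
end

section
/- Let G ∈ L²(0,1;ℂ). Define W(x) = ∫₀ˣ ds/a(s), C₂ = −(1/W(1)) ∫₀¹ (1/a(s)) (∫₀ˢ G(τ) dτ) ds, and θ(x) = ∫₀ˣ (1/a(s)) (∫₀ˢ G(τ) dτ) ds + C₂ W(x) for x ∈ [0,1]. Then θ is absolutely continuous on [0,1] with θ(0) = θ(1) = 0, a(x)θ'(x) = ∫₀ˣ G(s) ds + C₂ for a.e. x ∈ (0,1), the function aθ' is absolutely continuous on [0,1] with (aθ')' = G a.e. on (0,1), and √a·θ' ∈ L²(0,1). -/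
open MeasureTheory Set intervalIntegral Filter Topology

/-- (Weakly degenerate case.) The function
`θ(x) = ∫₀ˣ (1/a)(∫₀ˢ G) ds + C₂ W(x)`, with `W(x) = ∫₀ˣ ds/a(s)` and
`C₂ = −(1/W(1)) ∫₀¹ (1/a)(∫₀ˢ G) ds`, is absolutely continuous on `[0,1]` with
`θ(0) = θ(1) = 0`, satisfies `a θ' = ∫₀ˣ G + C₂` a.e., `aθ'` is absolutely continuous
with `(aθ')' = G` a.e., and `√a·θ' ∈ L²(0,1)`. -/
theorem stmt_8 (a : ℝ → ℝ)
    (haC : ContinuousOn a (Icc (0:ℝ) 1))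
    (haC1 : ContDiffOn ℝ 1 a (Ioc (0:ℝ) 1))
    (ha0 : a 0 = 0)
    (hapos : ∀ x ∈ Ioc (0:ℝ) 1, 0 < a x)
    (haL1 : IntegrableOn (fun x => (a x)⁻¹) (Ioc (0:ℝ) 1) volume)
    (G : ℝ → ℂ)
    (hGL2 : MemLp G 2 (volume.restrict (Ioc (0:ℝ) 1)))
    (W : ℝ → ℝ) (C₂ : ℂ) (θ : ℝ → ℂ)
    (hW : ∀ x ∈ Icc (0:ℝ) 1, W x = ∫ s in (0:ℝ)..x, (a s)⁻¹)
    (hC₂ : C₂ = -((W 1 : ℂ))⁻¹ * ∫ s in (0:ℝ)..1, ((a s : ℂ))⁻¹ * ∫ τ in (0:ℝ)..s, G τ)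
    (hθ : ∀ x ∈ Icc (0:ℝ) 1,
      θ x = (∫ s in (0:ℝ)..x, ((a s : ℂ))⁻¹ * ∫ τ in (0:ℝ)..s, G τ) + C₂ * (W x : ℂ)) :
    ∃ θ' : ℝ → ℂ,
      -- θ is absolutely continuous on [0,1] with a.e. derivative θ'
      IntervalIntegrable θ' volume 0 1 ∧
      (∀ x ∈ Icc (0:ℝ) 1, θ x = θ 0 + ∫ s in (0:ℝ)..x, θ' s) ∧
      θ 0 = 0 ∧ θ 1 = 0 ∧
      -- a θ' = ∫₀ˣ G + C₂ a.e. on (0,1); in particular aθ' extends to the absolutely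
      -- continuous function x ↦ ∫₀ˣ G + C₂, whose a.e. derivative is G
      (∀ᵐ x ∂volume, x ∈ Ioo (0:ℝ) 1 →
        (a x : ℂ) * θ' x = (∫ s in (0:ℝ)..x, G s) + C₂) ∧
      -- √a·θ' ∈ L²(0,1)
      MemLp (fun x => (Real.sqrt (a x) : ℂ) * θ' x) 2 (volume.restrict (Ioc (0:ℝ) 1)) := by
  have h01 : (0:ℝ) ≤ 1 := zero_le_one
  have hu : uIcc (0:ℝ) 1 = Icc 0 1 := uIcc_of_le h01
  have hG : IntervalIntegrable G volume 0 1 :=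
    (intervalIntegrable_iff_integrableOn_Ioc_of_le h01).2 (hGL2.integrable one_le_two)
  have hF : ContinuousOn (fun x => ∫ τ in (0:ℝ)..x, G τ) (uIcc 0 1) :=
    continuousOn_primitive_interval' hG left_mem_uIcc
  have hFC : ContinuousOn (fun x => (∫ τ in (0:ℝ)..x, G τ) + C₂) (uIcc 0 1) :=
    hF.add continuousOn_const
  have hinv : IntervalIntegrable (fun x => (a x)⁻¹) volume 0 1 :=
    (intervalIntegrable_iff_integrableOn_Ioc_of_le h01).2 haL1
  have hinvC : IntervalIntegrable (fun x => ((a x : ℂ))⁻¹) volume 0 1 := by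
    refine (intervalIntegrable_iff_integrableOn_Ioc_of_le h01).2 ?_
    simpa [IntegrableOn] using haL1.ofReal (𝕜 := ℂ)
  have hsub : ∀ {f : ℝ → ℂ}, IntervalIntegrable f volume 0 1 → ∀ x ∈ Icc (0:ℝ) 1,
      IntervalIntegrable f volume 0 x := fun hf x hx =>
    hf.mono_set (uIcc_subset_uIcc_left (hu ▸ hx))
  have hprod := hinvC.mul_continuousOn hF
  have hθ' := hinvC.mul_continuousOn hFC
  have hW1 : 0 < W 1 := by
    rw [hW 1 (right_mem_Icc.2 h01)]
    exact intervalIntegral_pos_of_pos_on hinv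
      (fun x hx => inv_pos.2 (hapos x (Ioo_subset_Ioc_self hx))) zero_lt_one
  have hθ0 : θ 0 = 0 := by
    rw [hθ 0 (left_mem_Icc.2 h01), hW 0 (left_mem_Icc.2 h01)]
    simp
  refine ⟨fun x => ((a x : ℂ))⁻¹ * ((∫ τ in (0:ℝ)..x, G τ) + C₂), hθ', ?_, hθ0, ?_, ?_, ?_⟩
  · intro x hx
    have hWx : (W x : ℂ) = ∫ s in (0:ℝ)..x, ((a s : ℂ))⁻¹ := by
      rw [hW x hx, ← intervalIntegral.integral_ofReal]
      simp
    simp only [mul_add]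
    rw [integral_add (hsub hprod x hx) ((hsub hinvC x hx).mul_const C₂),
      intervalIntegral.integral_mul_const, hθ x hx, hθ0, hWx]
    ring
  · have hne : (W 1 : ℂ) ≠ 0 := by exact_mod_cast hW1.ne'
    rw [hθ 1 (right_mem_Icc.2 h01), hC₂]
    field_simp
    ring
  · refine ae_of_all _ fun x hx => ?_
    have hne : (a x : ℂ) ≠ 0 := by exact_mod_cast (hapos x (Ioo_subset_Ioc_self hx)).ne'
    exact mul_inv_cancel_left₀ hne _
  · have hsqrt : AEStronglyMeasurable (fun x => (Real.sqrt (a x) : ℂ))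
        (volume.restrict (Ioc (0:ℝ) 1)) :=
      (Complex.continuous_ofReal.comp_continuousOn
        (haC.mono Ioc_subset_Icc_self).sqrt).aestronglyMeasurable measurableSet_Ioc
    have hθ'm : AEStronglyMeasurable
        (fun x => ((a x : ℂ))⁻¹ * ((∫ τ in (0:ℝ)..x, G τ) + C₂))
        (volume.restrict (Ioc (0:ℝ) 1)) :=
      hθ'.1.aestronglyMeasurable
    refine (memLp_two_iff_integrable_sq_norm (hsqrt.mul hθ'm)).2 ?_
    have hint : IntegrableOn (fun x => (a x)⁻¹ * ‖(∫ τ in (0:ℝ)..x, G τ) + C₂‖ ^ 2)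
        (Ioc (0:ℝ) 1) :=
      (hinv.mul_continuousOn (hFC.norm.pow 2)).1
    refine hint.congr_fun (fun x hx => ?_) measurableSet_Ioc
    have hpos := hapos x hx
    simp only [Pi.mul_apply, norm_mul, norm_inv, Complex.norm_real, Real.norm_eq_abs, mul_pow, sq_abs,
      Real.sq_sqrt hpos.le, inv_pow]
    field_simp
end

section
/- Assume in addition that ∫₀¹ x/a(x) dx < ∞. Let G ∈ L²(0,1;ℂ) and define θ(x) = − ∫ₓ¹ (1/a(s)) (∫₀ˢ G(τ) dτ) ds for x ∈ (0,1]. Then θ is locally absolutely continuous on (0,1] with θ(1) = 0, a(x)θ'(x) = ∫₀ˣ G(s) ds for a.e. x ∈ (0,1), so aθ' extends to an absolutely continuous function on [0,1] with (aθ')' = G a.e. on (0,1) and (aθ')(0) = 0; moreover ∫₀¹ a(x)|θ'(x)|² dx ≤ (∫₀¹ x/a(x) dx) · ∫₀¹ |G(s)|² ds, and θ ∈ L²(0,1). -/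
open MeasureTheory Set intervalIntegral Filter Topology

/-- The Cauchy–Schwarz inequality for lower Lebesgue integrals. -/
theorem sq_lintegral_mul_le {α : Type*} [MeasurableSpace α] {μ : Measure α} {f g : α → ENNReal}
    (hf : AEMeasurable f μ) (hg : AEMeasurable g μ) :
    (∫⁻ x, f x * g x ∂μ) ^ 2 ≤ (∫⁻ x, f x ^ 2 ∂μ) * ∫⁻ x, g x ^ 2 ∂μ := by
  have h := ENNReal.lintegral_mul_le_Lp_mul_Lq μ Real.HolderConjugate.two_two hf hg
  simp only [Pi.mul_apply, ENNReal.rpow_two] at h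
  refine (pow_le_pow_left' h 2).trans (le_of_eq ?_)
  rw [mul_pow, ← ENNReal.rpow_two, ← ENNReal.rpow_two, ← ENNReal.rpow_mul, ← ENNReal.rpow_mul]
  norm_num

/-- The primitive of an `L²` function satisfies `‖∫₀ˣ G‖² ≤ x ∫₀¹ ‖G‖²`. -/
theorem norm_sq_intervalIntegral_le {G : ℝ → ℂ}
    (hG : MemLp G 2 (volume.restrict (Ioc (0:ℝ) 1))) {x : ℝ} (hx : x ∈ Ioc (0:ℝ) 1) :
    ‖∫ s in (0:ℝ)..x, G s‖ ^ 2 ≤ x * ∫ s in (0:ℝ)..1, ‖G s‖ ^ 2 := by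
  have hsub : Ioc (0:ℝ) x ⊆ Ioc 0 1 := Ioc_subset_Ioc_right hx.2
  have hN : 0 ≤ ∫ s in (0:ℝ)..1, ‖G s‖ ^ 2 :=
    intervalIntegral.integral_nonneg zero_le_one fun _ _ => by positivity
  have hGx : AEMeasurable (fun s => ‖G s‖ₑ) (volume.restrict (Ioc (0:ℝ) x)) :=
    hG.1.enorm.mono_measure (Measure.restrict_mono hsub le_rfl)
  rw [← ENNReal.ofReal_le_ofReal_iff (mul_nonneg hx.1.le hN), ENNReal.ofReal_mul hx.1.le,
    ENNReal.ofReal_pow (norm_nonneg _), ofReal_norm, intervalIntegral.integral_of_le hx.1.le,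
    intervalIntegral.integral_of_le zero_le_one,
    ofReal_integral_eq_lintegral_ofReal hG.integrable_norm_pow'
      (Eventually.of_forall fun _ => by positivity)]
  calc ‖∫ s in Ioc 0 x, G s‖ₑ ^ 2
      ≤ (∫⁻ s in Ioc 0 x, 1 * ‖G s‖ₑ) ^ 2 := by
        simpa only [one_mul] using pow_le_pow_left' (enorm_integral_le_lintegral_enorm _) 2
    _ ≤ (∫⁻ _ in Ioc 0 x, 1 ^ 2) * ∫⁻ s in Ioc 0 x, ‖G s‖ₑ ^ 2 :=
        sq_lintegral_mul_le aemeasurable_const hGx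
    _ ≤ ENNReal.ofReal x * ∫⁻ s in Ioc 0 1, ENNReal.ofReal (‖G s‖ ^ 2) := by
        simp only [one_pow, lintegral_const, Measure.restrict_apply_univ, Real.volume_Ioc,
          sub_zero, one_mul, ENNReal.ofReal_pow (norm_nonneg _), ofReal_norm]
        gcongr

/-- A primitive vanishing at `1` of a function continuous on `(0,1]` is continuous on `(0,1]`. -/
theorem continuousOn_intervalIntegral_one {g : ℝ → ℂ} (hg : ContinuousOn g (Ioc 0 1)) :
    ContinuousOn (fun x => ∫ s in x..(1:ℝ), g s) (Ioc 0 1) := by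
  intro x hx
  have h2 : x / 2 ≤ 1 := by linarith [hx.1, hx.2]
  have hint : IntervalIntegrable g volume (x / 2) 1 := by
    refine ContinuousOn.intervalIntegrable (hg.mono ?_)
    rw [uIcc_of_le h2]
    exact fun y hy => ⟨by linarith [hx.1, hy.1], hy.2⟩
  have hc : ContinuousOn (fun y => ∫ s in y..(1:ℝ), g s) (uIcc (x / 2) 1) := by
    refine ((intervalIntegral.continuousOn_primitive_interval' hint right_mem_uIcc).neg).congr ?_
    intro y _
    exact intervalIntegral.integral_symm _ _
  rw [uIcc_of_le h2] at hc
  refine (hc x ⟨by linarith [hx.1], hx.2⟩).mono_of_mem_nhdsWithin ?_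
  filter_upwards [self_mem_nhdsWithin,
    mem_nhdsWithin_of_mem_nhds (lt_mem_nhds (half_lt_self hx.1))] with y hy hy'
  exact ⟨hy'.le, hy.2⟩

/-- Tonelli's theorem on the triangle `0 < x < s ≤ 1`. -/
theorem lintegral_Ioc_lintegral_Ioc {w : ℝ → ENNReal} (hw : Measurable w) :
    ∫⁻ x in Ioc (0:ℝ) 1, ∫⁻ s in Ioc x 1, w s
      = ∫⁻ s in Ioc (0:ℝ) 1, ENNReal.ofReal s * w s := by
  have hT : MeasurableSet {p : ℝ × ℝ | 0 < p.1 ∧ p.1 < p.2 ∧ p.2 ≤ 1} :=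
    (measurableSet_lt measurable_const measurable_fst).inter
      ((measurableSet_lt measurable_fst measurable_snd).inter
        (measurableSet_le measurable_snd measurable_const))
  let k : ℝ → ℝ → ENNReal := fun x s =>
    {p : ℝ × ℝ | 0 < p.1 ∧ p.1 < p.2 ∧ p.2 ≤ 1}.indicator (fun p => w p.2) (x, s)
  have hk : Measurable (Function.uncurry k) := (hw.comp measurable_snd).indicator hT
  have hl : ∫⁻ x in Ioc (0:ℝ) 1, ∫⁻ s in Ioc x 1, w s = ∫⁻ x, ∫⁻ s, k x s := by
    rw [← lintegral_indicator measurableSet_Ioc]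
    refine lintegral_congr fun x => ?_
    by_cases hx : x ∈ Ioc (0:ℝ) 1
    · rw [indicator_of_mem hx, ← lintegral_indicator measurableSet_Ioc]
      refine lintegral_congr fun s => ?_
      simp [k, indicator_apply, hx.1]
    · rw [indicator_of_notMem hx]
      have : ∀ s, k x s = 0 := fun s =>
        indicator_of_notMem (fun h => hx ⟨h.1, h.2.1.le.trans h.2.2⟩) _
      simp [this]
  have hr : ∫⁻ s in Ioc (0:ℝ) 1, ENNReal.ofReal s * w s = ∫⁻ s, ∫⁻ x, k x s := by
    rw [← lintegral_indicator measurableSet_Ioc]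
    refine lintegral_congr fun s => ?_
    by_cases hs : s ∈ Ioc (0:ℝ) 1
    · have : ∀ x, k x s = (Ioo 0 s).indicator (fun _ => w s) x := fun x => by
        simp [k, indicator_apply, hs.2]
      simp only [this]
      rw [indicator_of_mem hs, lintegral_indicator measurableSet_Ioo]
      simp [mul_comm]
    · rw [indicator_of_notMem hs]
      have : ∀ x, k x s = 0 := fun x =>
        indicator_of_notMem (fun h => hs ⟨h.1.trans h.2.1, h.2.2⟩) _
      simp [this]
  rw [hl, hr, lintegral_lintegral_swap hk.aemeasurable]

/-- If `a > 0` on `(0,1]`, `x/a` is integrable and `‖F x‖² ≤ N x`, then `∫ₓ¹ F/a` is in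
`L²(0,1)`. -/
theorem memLp_two_intervalIntegral_inv_mul {a : ℝ → ℝ} {F : ℝ → ℂ} {N : ℝ}
    (ha : ContinuousOn a (Ioc 0 1)) (hapos : ∀ x ∈ Ioc (0:ℝ) 1, 0 < a x)
    (hxa : IntegrableOn (fun x => x / a x) (Ioc (0:ℝ) 1) volume)
    (hF : ContinuousOn F (Ioc 0 1)) (hFN : ∀ x ∈ Ioc (0:ℝ) 1, ‖F x‖ ^ 2 ≤ x * N) :
    MemLp (fun x => ∫ s in x..(1:ℝ), (a s : ℂ)⁻¹ * F s) 2 (volume.restrict (Ioc (0:ℝ) 1)) := by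
  have hg : ContinuousOn (fun s => (a s : ℂ)⁻¹ * F s) (Ioc 0 1) :=
    ((Complex.continuous_ofReal.comp_continuousOn ha).inv₀ fun x hx =>
      Complex.ofReal_ne_zero.2 (hapos x hx).ne').mul hF
  refine ⟨(continuousOn_intervalIntegral_one hg).aestronglyMeasurable measurableSet_Ioc, ?_⟩
  -- `v = 1/√a` on `(0,1]`, extended by zero
  let v : ℝ → ℝ := (Ioc (0:ℝ) 1).piecewise (fun s => (√(a s))⁻¹) fun _ => 0
  have hv : Measurable v := ContinuousOn.measurable_piecewise
    ((Real.continuous_sqrt.comp_continuousOn ha).inv₀ fun x hx =>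
      (Real.sqrt_pos.2 (hapos x hx)).ne') continuousOn_const measurableSet_Ioc
  have hv0 : ∀ s ∈ Ioc (0:ℝ) 1, 0 ≤ v s := fun s hs => by
    simp only [v, piecewise_eq_of_mem _ _ _ hs]; positivity
  have hv2 : ∀ s ∈ Ioc (0:ℝ) 1, v s ^ 2 = (a s)⁻¹ := fun s hs => by
    simp only [v, piecewise_eq_of_mem _ _ _ hs, inv_pow, Real.sq_sqrt (hapos s hs).le]
  let w : ℝ → ENNReal := fun s => ENNReal.ofReal (v s)
  have hw : Measurable w := hv.ennreal_ofReal
  have hwsq : ∀ s ∈ Ioc (0:ℝ) 1, w s ^ 2 = ENNReal.ofReal (a s)⁻¹ := fun s hs => by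
    simp only [w, ← ENNReal.ofReal_pow (hv0 s hs), hv2 s hs]
  have hK : ∫⁻ s in Ioc (0:ℝ) 1, ENNReal.ofReal s * w s ^ 2 < ⊤ := by
    refine lt_of_le_of_lt (le_of_eq ?_) hxa.2
    refine setLIntegral_congr_fun measurableSet_Ioc fun s hs => ?_
    simp only
    rw [hwsq s hs, ← ENNReal.ofReal_mul hs.1.le, ← div_eq_mul_inv,
      Real.enorm_of_nonneg (div_nonneg hs.1.le (hapos s hs).le)]
  have hE : ∫⁻ s in Ioc (0:ℝ) 1, (w s * ‖F s‖ₑ) ^ 2 < ⊤ := by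
    calc ∫⁻ s in Ioc (0:ℝ) 1, (w s * ‖F s‖ₑ) ^ 2
        ≤ ∫⁻ s in Ioc (0:ℝ) 1, ENNReal.ofReal N * (ENNReal.ofReal s * w s ^ 2) := by
          refine setLIntegral_mono' measurableSet_Ioc fun s hs => ?_
          have h := ENNReal.ofReal_le_ofReal (hFN s hs)
          rw [ENNReal.ofReal_pow (norm_nonneg _), ofReal_norm,
            ENNReal.ofReal_mul hs.1.le] at h
          calc (w s * ‖F s‖ₑ) ^ 2 = w s ^ 2 * ‖F s‖ₑ ^ 2 := mul_pow _ _ _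
            _ ≤ w s ^ 2 * (ENNReal.ofReal s * ENNReal.ofReal N) := by gcongr
            _ = _ := by ring
      _ = ENNReal.ofReal N * ∫⁻ s in Ioc (0:ℝ) 1, ENNReal.ofReal s * w s ^ 2 :=
          lintegral_const_mul' _ _ ENNReal.ofReal_ne_top
      _ < ⊤ := ENNReal.mul_lt_top ENNReal.ofReal_lt_top hK
  have hbound : ∀ x ∈ Ioc (0:ℝ) 1, ‖∫ s in x..(1:ℝ), (a s : ℂ)⁻¹ * F s‖ₑ ^ 2
      ≤ (∫⁻ s in Ioc x 1, w s ^ 2) * ∫⁻ s in Ioc (0:ℝ) 1, (w s * ‖F s‖ₑ) ^ 2 := by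
    intro x hx
    have hsub : Ioc x 1 ⊆ Ioc (0:ℝ) 1 := Ioc_subset_Ioc_left hx.1.le
    have hFm : AEMeasurable (fun s => ‖F s‖ₑ) (volume.restrict (Ioc x 1)) :=
      ((hF.mono hsub).aestronglyMeasurable measurableSet_Ioc).enorm
    rw [intervalIntegral.integral_of_le hx.2]
    calc ‖∫ s in Ioc x 1, (a s : ℂ)⁻¹ * F s‖ₑ ^ 2
        ≤ (∫⁻ s in Ioc x 1, ‖(a s : ℂ)⁻¹ * F s‖ₑ) ^ 2 :=
          pow_le_pow_left' (enorm_integral_le_lintegral_enorm _) 2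
      _ = (∫⁻ s in Ioc x 1, w s * (w s * ‖F s‖ₑ)) ^ 2 := by
          congr 1
          refine setLIntegral_congr_fun measurableSet_Ioc fun s hs => ?_
          have hpos := hapos s (hsub hs)
          have : ‖(a s : ℂ)⁻¹‖ₑ = w s ^ 2 := by
            rw [hwsq s (hsub hs), ← ofReal_norm, norm_inv, Complex.norm_real,
              Real.norm_of_nonneg hpos.le]
          rw [enorm_mul, this, sq, mul_assoc]
      _ ≤ (∫⁻ s in Ioc x 1, w s ^ 2) * ∫⁻ s in Ioc x 1, (w s * ‖F s‖ₑ) ^ 2 :=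
          sq_lintegral_mul_le hw.aemeasurable (hw.aemeasurable.mul hFm)
      _ ≤ _ := by gcongr
  rw [eLpNorm_lt_top_iff_lintegral_rpow_enorm_lt_top two_ne_zero ENNReal.ofNat_ne_top]
  simp only [ENNReal.toReal_ofNat, ENNReal.rpow_two]
  refine (setLIntegral_mono' measurableSet_Ioc hbound).trans_lt ?_
  rw [lintegral_mul_const' _ _ hE.ne, lintegral_Ioc_lintegral_Ioc (hw.pow_const 2)]
  exact ENNReal.mul_lt_top hK hE

/-- (Strongly degenerate case, assuming `∫₀¹ x/a(x) dx < ∞`.) The function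
`θ(x) = −∫ₓ¹ (1/a)(∫₀ˢ G) ds` is locally absolutely continuous on `(0,1]` with `θ(1) = 0`,
`a θ' = ∫₀ˣ G` a.e. (so `aθ'` extends to an absolutely continuous function with
`(aθ')' = G` a.e. and `(aθ')(0) = 0`), `∫₀¹ a|θ'|² ≤ (∫₀¹ x/a) ∫₀¹ |G|²`, and `θ ∈ L²(0,1)`. -/
theorem stmt_9 (a : ℝ → ℝ)
    (haC1 : ContDiffOn ℝ 1 a (Icc (0:ℝ) 1))
    (ha0 : a 0 = 0)
    (hapos : ∀ x ∈ Ioc (0:ℝ) 1, 0 < a x)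
    (hanotL1 : ¬ IntegrableOn (fun x => (a x)⁻¹) (Ioc (0:ℝ) 1) volume)
    (hasqrtL1 : IntegrableOn (fun x => (Real.sqrt (a x))⁻¹) (Ioc (0:ℝ) 1) volume)
    (hxaL1 : IntegrableOn (fun x => x / a x) (Ioc (0:ℝ) 1) volume)
    (G : ℝ → ℂ)
    (hGL2 : MemLp G 2 (volume.restrict (Ioc (0:ℝ) 1)))
    (θ : ℝ → ℂ)
    (hθ : ∀ x ∈ Ioc (0:ℝ) 1,
      θ x = -∫ s in x..(1:ℝ), ((a s : ℂ))⁻¹ * ∫ τ in (0:ℝ)..s, G τ) :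
    ∃ θ' : ℝ → ℂ,
      -- θ is locally absolutely continuous on (0,1] with a.e. derivative θ' and θ(1) = 0
      (∀ ε ∈ Ioc (0:ℝ) 1, IntervalIntegrable θ' volume ε 1) ∧
      (∀ x ∈ Ioc (0:ℝ) 1, θ x = θ 1 - ∫ s in x..(1:ℝ), θ' s) ∧
      θ 1 = 0 ∧
      -- a θ' = ∫₀ˣ G a.e. on (0,1); hence aθ' extends to the absolutely continuous
      -- function x ↦ ∫₀ˣ G, with a.e. derivative G and value 0 at x = 0
      (∀ᵐ x ∂volume, x ∈ Ioo (0:ℝ) 1 →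
        (a x : ℂ) * θ' x = ∫ s in (0:ℝ)..x, G s) ∧
      -- energy estimate
      (∫ x in (0:ℝ)..1, a x * ‖θ' x‖ ^ 2)
        ≤ (∫ x in (0:ℝ)..1, x / a x) * ∫ s in (0:ℝ)..1, ‖G s‖ ^ 2 ∧
      -- θ ∈ L²(0,1)
      MemLp θ 2 (volume.restrict (Ioc (0:ℝ) 1)) := by
  have ha : ContinuousOn a (Ioc 0 1) := haC1.continuousOn.mono Ioc_subset_Icc_self
  let F : ℝ → ℂ := fun x => ∫ τ in (0:ℝ)..x, G τ
  have hGint : IntervalIntegrable G volume 0 1 :=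
    (intervalIntegrable_iff_integrableOn_Ioc_of_le zero_le_one).2 (hGL2.integrable one_le_two)
  have hF : ContinuousOn F (Ioc 0 1) := by
    have h := intervalIntegral.continuousOn_primitive_interval' hGint left_mem_uIcc
    rw [uIcc_of_le zero_le_one] at h
    exact h.mono Ioc_subset_Icc_self
  have hac : ∀ x ∈ Ioc (0:ℝ) 1, (a x : ℂ) ≠ 0 := fun x hx =>
    Complex.ofReal_ne_zero.2 (hapos x hx).ne'
  have hg : ContinuousOn (fun s => (a s : ℂ)⁻¹ * F s) (Ioc 0 1) :=
    ((Complex.continuous_ofReal.comp_continuousOn ha).inv₀ hac).mul hF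
  have hθ1 : θ 1 = 0 := by simp [hθ 1 (by simp)]
  refine ⟨fun s => (a s : ℂ)⁻¹ * F s, ?_, ?_, hθ1, ?_, ?_, ?_⟩
  · intro ε hε
    refine ContinuousOn.intervalIntegrable (hg.mono ?_)
    rw [uIcc_of_le hε.2]
    exact fun y hy => ⟨hε.1.trans_le hy.1, hy.2⟩
  · intro x hx
    rw [hθ1, hθ x hx, zero_sub]
  · exact Eventually.of_forall fun x hx =>
      mul_inv_cancel_left₀ (hac x (Ioo_subset_Ioc_self hx)) _
  · rw [← intervalIntegral.integral_mul_const, intervalIntegral.integral_of_le zero_le_one,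
      intervalIntegral.integral_of_le zero_le_one]
    refine integral_mono_of_nonneg ?_ (hxaL1.mul_const _) ?_
    · filter_upwards [ae_restrict_mem measurableSet_Ioc] with x hx
      exact mul_nonneg (hapos x hx).le (by positivity)
    · filter_upwards [ae_restrict_mem measurableSet_Ioc] with x hx
      have hpos := hapos x hx
      have h := norm_sq_intervalIntegral_le hGL2 hx
      calc a x * ‖(a x : ℂ)⁻¹ * F x‖ ^ 2 = ‖F x‖ ^ 2 / a x := by
            rw [norm_mul, norm_inv, Complex.norm_real, Real.norm_of_nonneg hpos.le]
            field_simp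
        _ ≤ (x * ∫ s in (0:ℝ)..1, ‖G s‖ ^ 2) / a x := by gcongr
        _ = _ := by ring
  · refine (memLp_congr_ae ?_).1 (memLp_two_intervalIntegral_inv_mul ha hapos hxaL1 hF
      fun x hx => norm_sq_intervalIntegral_le hGL2 hx).neg
    filter_upwards [ae_restrict_mem measurableSet_Ioc] with x hx
    exact (hθ x hx).symm
end

section
/- Let a : (0,1] → ℝ be measurable with a(x) > 0 for all x ∈ (0,1] and ∫₀¹ s/a(s) ds < ∞. Let θ : (0,1] → ℂ be locally absolutely continuous on (0,1] with θ(1) = 0 and √a·θ' ∈ L²(0,1). Then for every x ∈ (0,1], |θ(x)|² ≤ (∫ₓ¹ ds/a(s)) · ∫ₓ¹ a(s)|θ'(s)|² ds, and consequently ∫₀¹ |θ(x)|² dx ≤ (∫₀¹ s/a(s) ds) · ∫₀¹ a(s)|θ'(s)|² ds. -/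
open MeasureTheory Set intervalIntegral Filter Topology

/-- Cauchy–Schwarz inequality for nonnegative square-integrable functions, in squared form. -/
theorem sq_integral_mul_le_of_nonneg {α : Type*} [MeasurableSpace α] {μ : Measure α} {f g : α → ℝ}
    (hf0 : 0 ≤ᵐ[μ] f) (hg0 : 0 ≤ᵐ[μ] g) (hf : MemLp f 2 μ) (hg : MemLp g 2 μ) :
    (∫ x, f x * g x ∂μ) ^ 2 ≤ (∫ x, f x ^ 2 ∂μ) * ∫ x, g x ^ 2 ∂μ := by
  have h := integral_mul_le_Lp_mul_Lq_of_nonneg Real.HolderConjugate.two_two hf0 hg0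
    (by simpa using hf) (by simpa using hg)
  simp only [Real.rpow_ofNat, ← Real.sqrt_eq_rpow] at h
  have h0 : 0 ≤ ∫ x, f x * g x ∂μ := by
    apply MeasureTheory.integral_nonneg_of_ae
    filter_upwards [hf0, hg0] with x hx hx'
    exact mul_nonneg hx hx'
  calc (∫ x, f x * g x ∂μ) ^ 2
      ≤ (√(∫ x, f x ^ 2 ∂μ) * √(∫ x, g x ^ 2 ∂μ)) ^ 2 := by gcongr
    _ = _ := by
      rw [mul_pow, Real.sq_sqrt (integral_nonneg fun _ => sq_nonneg _),
        Real.sq_sqrt (integral_nonneg fun _ => sq_nonneg _)]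

/-- Weighted Cauchy–Schwarz inequality with a weight `a` positive almost everywhere. -/
theorem sq_norm_integral_le_integral_inv_mul_integral_mul_sq {α E : Type*} [MeasurableSpace α]
    [NormedAddCommGroup E] [NormedSpace ℝ E] {μ : Measure α} {a : α → ℝ} {f : α → E}
    (ha : AEStronglyMeasurable a μ) (ha0 : ∀ᵐ x ∂μ, 0 < a x)
    (hainv : Integrable (fun x => (a x)⁻¹) μ) (hf : MemLp (fun x => √(a x) * ‖f x‖) 2 μ) :
    ‖∫ x, f x ∂μ‖ ^ 2 ≤ (∫ x, (a x)⁻¹ ∂μ) * ∫ x, a x * ‖f x‖ ^ 2 ∂μ := by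
  have hm : AEStronglyMeasurable (fun x => √(a x)⁻¹) μ :=
    (Real.continuous_sqrt.measurable.comp_aemeasurable ha.aemeasurable.inv).aestronglyMeasurable
  have hsq : (fun x => √(a x)⁻¹ ^ 2) =ᵐ[μ] fun x => (a x)⁻¹ := by
    filter_upwards [ha0] with x hx
    exact Real.sq_sqrt (inv_nonneg.2 hx.le)
  have h2 : MemLp (fun x => √(a x)⁻¹) 2 μ :=
    (memLp_two_iff_integrable_sq hm).2 (hainv.congr hsq.symm)
  have h := sq_integral_mul_le_of_nonneg (.of_forall fun x => Real.sqrt_nonneg _)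
    (.of_forall fun x => by positivity) h2 hf
  rw [integral_congr_ae hsq] at h
  have e1 : ∫ x, √(a x)⁻¹ * (√(a x) * ‖f x‖) ∂μ = ∫ x, ‖f x‖ ∂μ := by
    apply MeasureTheory.integral_congr_ae
    filter_upwards [ha0] with x hx
    have := (Real.sqrt_pos.2 hx).ne'
    rw [Real.sqrt_inv, inv_mul_cancel_left₀ this]
  have e2 : ∫ x, (√(a x) * ‖f x‖) ^ 2 ∂μ = ∫ x, a x * ‖f x‖ ^ 2 ∂μ := by
    apply MeasureTheory.integral_congr_ae
    filter_upwards [ha0] with x hx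
    rw [mul_pow, Real.sq_sqrt hx.le]
  rw [e1, e2] at h
  refine le_trans ?_ h
  gcongr
  exact norm_integral_le_integral_norm f

/-- Fubini's theorem on the triangle `0 < x < s ≤ 1`. -/
theorem integrableOn_integral_tail_and_eq {g : ℝ → ℝ} (hg : Measurable g)
    (hsg : IntegrableOn (fun s => s * g s) (Ioc (0:ℝ) 1)) :
    IntegrableOn (fun x => ∫ s in Ioc x 1, g s) (Ioc (0:ℝ) 1) ∧
      ∫ x in Ioc (0:ℝ) 1, ∫ s in Ioc x 1, g s = ∫ s in Ioc (0:ℝ) 1, s * g s := by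
  set F : ℝ → ℝ → ℝ := fun x s => (Iio s).indicator (fun _ => g s) x with hF
  have hFm : Measurable (Function.uncurry F) := by
    have : Function.uncurry F = {p : ℝ × ℝ | p.1 < p.2}.indicator (fun p => g p.2) := by
      ext p
      simp [hF, Function.uncurry, indicator]
    rw [this]
    exact (hg.comp measurable_snd).indicator (measurableSet_lt measurable_fst measurable_snd)
  have hx (c s : ℝ) (hs : s ∈ Ioc (0:ℝ) 1) :
      ∫ x in Ioc (0:ℝ) 1, (Iio s).indicator (fun _ => c) x = s * c := by
    have : Ioc (0:ℝ) 1 ∩ Iio s = Ioo 0 s := by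
      ext x
      simp only [mem_inter_iff, mem_Ioc, mem_Iio, mem_Ioo]
      exact ⟨fun h => ⟨h.1.1, h.2⟩, fun h => ⟨⟨h.1, h.2.le.trans hs.2⟩, h.2⟩⟩
    rw [setIntegral_indicator measurableSet_Iio, this]
    simp [hs.1.le]
  have hs (x : ℝ) (hx : x ∈ Ioc (0:ℝ) 1) :
      ∫ s in Ioc (0:ℝ) 1, F x s = ∫ s in Ioc x 1, g s := by
    have e : F x = (Ioi x).indicator g := by
      ext s
      simp [hF, indicator]
    have : Ioc (0:ℝ) 1 ∩ Ioi x = Ioc x 1 := by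
      ext s
      simp only [mem_inter_iff, mem_Ioc, mem_Ioi]
      exact ⟨fun h => ⟨h.2, h.1.2⟩, fun h => ⟨⟨hx.1.trans h.1, h.2⟩, h.1⟩⟩
    rw [e, setIntegral_indicator measurableSet_Ioi, this]
  have hFi : Integrable (Function.uncurry F)
      ((volume.restrict (Ioc (0:ℝ) 1)).prod (volume.restrict (Ioc (0:ℝ) 1))) := by
    rw [integrable_prod_iff' hFm.aestronglyMeasurable]
    refine ⟨.of_forall fun s => (integrable_const (g s)).indicator measurableSet_Iio, ?_⟩
    refine hsg.norm.congr ?_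
    filter_upwards [ae_restrict_mem measurableSet_Ioc] with s hs
    simp only [Function.uncurry, hF, norm_indicator_eq_indicator_norm]
    rw [hx _ s hs, norm_mul, Real.norm_of_nonneg hs.1.le]
  constructor
  · refine hFi.integral_prod_left.congr ?_
    filter_upwards [ae_restrict_mem measurableSet_Ioc] with x hx
    exact hs x hx
  · rw [← setIntegral_congr_fun measurableSet_Ioc hs, integral_integral_swap hFi]
    exact setIntegral_congr_fun measurableSet_Ioc fun s => hx (g s) s

/-- If `θ` is locally absolutely continuous on `(0,1]` with `θ(1) = 0`
and `√a·θ' ∈ L²(0,1)`, then `|θ(x)|² ≤ (∫ₓ¹ ds/a(s)) ∫ₓ¹ a|θ'|²` for every `x ∈ (0,1]`,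
and consequently `∫₀¹ |θ|² ≤ (∫₀¹ s/a(s) ds) ∫₀¹ a|θ'|²`. -/
theorem stmt_14 (a : ℝ → ℝ)
    (hameas : Measurable a)
    (hapos : ∀ x ∈ Ioc (0:ℝ) 1, 0 < a x)
    (hxaL1 : IntegrableOn (fun s => s / a s) (Ioc (0:ℝ) 1) volume)
    (θ θ' : ℝ → ℂ)
    (hθ'locint : ∀ ε ∈ Ioc (0:ℝ) 1, IntervalIntegrable θ' volume ε 1)
    (hθlocAC : ∀ x ∈ Ioc (0:ℝ) 1, θ x = θ 1 - ∫ s in x..(1:ℝ), θ' s)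
    (hθ1 : θ 1 = 0)
    (hθ'L2 : MemLp (fun x => (Real.sqrt (a x) : ℂ) * θ' x) 2 (volume.restrict (Ioc (0:ℝ) 1))) :
    (∀ x ∈ Ioc (0:ℝ) 1,
      ‖θ x‖ ^ 2 ≤ (∫ s in x..(1:ℝ), (a s)⁻¹) * ∫ s in x..(1:ℝ), a s * ‖θ' s‖ ^ 2) ∧
    ∫ x in (0:ℝ)..1, ‖θ x‖ ^ 2
      ≤ (∫ s in (0:ℝ)..1, s / a s) * ∫ s in (0:ℝ)..1, a s * ‖θ' s‖ ^ 2 := by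
  have hL2 : MemLp (fun x => √(a x) * ‖θ' x‖) 2 (volume.restrict (Ioc (0:ℝ) 1)) := by
    refine hθ'L2.norm.congr_norm ?_ (.of_forall fun x => ?_)
    · refine hθ'L2.norm.1.congr (.of_forall fun x => ?_)
      simp [abs_of_nonneg (Real.sqrt_nonneg _)]
    · simp [abs_of_nonneg (Real.sqrt_nonneg _)]
  have henergy : IntegrableOn (fun s => a s * ‖θ' s‖ ^ 2) (Ioc (0:ℝ) 1) := by
    refine hL2.integrable_sq.congr ?_
    filter_upwards [ae_restrict_mem measurableSet_Ioc] with s hs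
    rw [mul_pow, Real.sq_sqrt (hapos s hs).le]
  have hpt : ∀ x ∈ Ioc (0:ℝ) 1,
      ‖θ x‖ ^ 2 ≤ (∫ s in Ioc x 1, (a s)⁻¹) * ∫ s in Ioc x 1, a s * ‖θ' s‖ ^ 2 := by
    intro x hx
    have hsub : Ioc x 1 ⊆ Ioc (0:ℝ) 1 := Ioc_subset_Ioc_left hx.1.le
    have hinv : IntegrableOn (fun s => (a s)⁻¹) (Ioc x 1) := by
      refine ((hxaL1.mono_set hsub).const_mul x⁻¹).mono' hameas.inv.aestronglyMeasurable ?_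
      filter_upwards [ae_restrict_mem measurableSet_Ioc] with s hs
      have ha := hapos s (hsub hs)
      have h1 : 1 ≤ x⁻¹ * s := by
        rw [inv_mul_eq_div, one_le_div hx.1]
        exact hs.1.le
      rw [Real.norm_of_nonneg (inv_nonneg.2 ha.le), div_eq_mul_inv, ← mul_assoc]
      exact le_mul_of_one_le_left (inv_nonneg.2 ha.le) h1
    rw [hθlocAC x hx, hθ1, zero_sub, norm_neg, integral_of_le hx.2]
    refine sq_norm_integral_le_integral_inv_mul_integral_mul_sq hameas.aestronglyMeasurable ?_ hinv
      (hL2.mono_measure (Measure.restrict_mono hsub le_rfl))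
    filter_upwards [ae_restrict_mem measurableSet_Ioc] with s hs using hapos s (hsub hs)
  refine ⟨fun x hx => ?_, ?_⟩
  · rw [integral_of_le hx.2, integral_of_le hx.2]
    exact hpt x hx
  simp only [integral_of_le zero_le_one, div_eq_mul_inv] at hxaL1 ⊢
  obtain ⟨htail, heq⟩ := integrableOn_integral_tail_and_eq hameas.inv hxaL1
  simp only [Pi.inv_apply] at htail heq
  rw [← heq, ← MeasureTheory.integral_mul_const]
  refine integral_mono_of_nonneg (.of_forall fun x => sq_nonneg _) (htail.mul_const _) ?_
  filter_upwards [ae_restrict_mem measurableSet_Ioc] with x hx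
  have hsub : Ioc x 1 ⊆ Ioc (0:ℝ) 1 := Ioc_subset_Ioc_left hx.1.le
  refine (hpt x hx).trans (mul_le_mul_of_nonneg_left ?_ ?_)
  · refine setIntegral_mono_set henergy ?_ hsub.eventuallyLE
    filter_upwards [ae_restrict_mem measurableSet_Ioc] with s hs
    exact mul_nonneg (hapos s hs).le (sq_nonneg _)
  · exact setIntegral_nonneg measurableSet_Ioc fun s hs => inv_nonneg.2 (hapos s (hsub hs)).le
end

section
/- Let κ > 0. There exists a constant C > 0, depending only on κ, such that the following holds for every λ ∈ ℝ: if u : [0,1] → ℂ is absolutely continuous with u(0) = 0 and u' ∈ L²(0,1), θ ∈ L²(0,1;ℂ), F ∈ L²(0,1;ℂ), and the function w := u' − κθ is absolutely continuous on [0,1] with w' ∈ L²(0,1) and w' + λ²u = F a.e. on (0,1), then |w(0)|² ≤ C( ‖w‖² + λ²‖u‖² + ‖F‖·‖w‖ + λ²‖θ‖·‖u‖ ), where ‖·‖ denotes the L²(0,1) norm. -/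
open MeasureTheory Set intervalIntegral Filter Topology

/-- The `L²(0,1)` norm. -/
noncomputable def L2norm (f : ℝ → ℂ) : ℝ := (∫ x in (0:ℝ)..1, ‖f x‖ ^ 2) ^ ((1:ℝ)/2)

/-- The weighted energy pairing `∫₀¹ (1 - x) · 2 Re (f ḡ) dx`. -/
noncomputable def weightedPairing (f g : ℝ → ℂ) : ℝ :=
  ∫ x in (0:ℝ)..1, (1 - x) * (2 * ((f x).re * (g x).re + (f x).im * (g x).im))

/-- The energy identity for an absolutely continuous function, from integrating the derivative
of `(1 - x) ‖f x‖²`. -/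
theorem weightedPairing_deriv_self {f f' : ℝ → ℂ} (hf' : IntervalIntegrable f' volume 0 1)
    (hf : ∀ x ∈ Icc (0:ℝ) 1, f x = f 0 + ∫ s in (0:ℝ)..x, f' s) :
    weightedPairing f' f = (∫ x in (0:ℝ)..1, ‖f x‖ ^ 2) - ‖f 0‖ ^ 2 := by
  have hre : IntervalIntegrable (fun x => (f' x).re) volume 0 1 :=
    ⟨hf'.1.re, hf'.2.re⟩
  have him : IntervalIntegrable (fun x => (f' x).im) volume 0 1 :=
    ⟨hf'.1.im, hf'.2.im⟩
  set p : ℝ → ℝ := fun x => (f 0).re + ∫ s in (0:ℝ)..x, (f' s).re with hp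
  set q : ℝ → ℝ := fun x => (f 0).im + ∫ s in (0:ℝ)..x, (f' s).im with hq
  have hconst (c : ℝ) : AbsolutelyContinuousOnInterval (fun _ : ℝ => c) 0 1 :=
    contDiff_const.contDiffOn.absolutelyContinuousOnInterval
  have hpac : AbsolutelyContinuousOnInterval p 0 1 :=
    (hconst _).fun_add (hre.absolutelyContinuousOnInterval_intervalIntegral (by simp))
  have hqac : AbsolutelyContinuousOnInterval q 0 1 :=
    (hconst _).fun_add (him.absolutelyContinuousOnInterval_intervalIntegral (by simp))
  have hwac : AbsolutelyContinuousOnInterval (fun x : ℝ => 1 - x) 0 1 :=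
    (contDiff_const.sub contDiff_id).contDiffOn.absolutelyContinuousOnInterval
  have hHac := hwac.fun_mul ((hpac.fun_mul hpac).fun_add (hqac.fun_mul hqac))
  have hfp : ∀ x ∈ Icc (0:ℝ) 1, (f x).re = p x ∧ (f x).im = q x := by
    intro x hx
    have hsub : IntervalIntegrable f' volume 0 x :=
      hf'.mono_set (by
        rw [uIcc_of_le hx.1, uIcc_of_le zero_le_one]
        exact Icc_subset_Icc_right hx.2)
    have h1 := Complex.reCLM.intervalIntegral_comp_comm hsub
    have h2 := Complex.imCLM.intervalIntegral_comp_comm hsub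
    simp only [Complex.reCLM_apply, Complex.imCLM_apply] at h1 h2
    rw [hf x hx]
    simp [hp, hq, h1, h2]
  have hp0 : p 0 = (f 0).re := by simp [hp]
  have hq0 : q 0 = (f 0).im := by simp [hq]
  have hnorm (z : ℂ) : ‖z‖ ^ 2 = z.re * z.re + z.im * z.im := by
    rw [Complex.sq_norm, Complex.normSq_apply]
  have hpair : weightedPairing f' f =
      ∫ x in (0:ℝ)..1, (1 - x) * (2 * ((f' x).re * p x + (f' x).im * q x)) := by
    refine integral_congr fun x hx => ?_
    rw [uIcc_of_le zero_le_one] at hx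
    simp only [hfp x hx]
  have hsq : ∫ x in (0:ℝ)..1, ‖f x‖ ^ 2 = ∫ x in (0:ℝ)..1, (p x * p x + q x * q x) := by
    refine integral_congr fun x hx => ?_
    rw [uIcc_of_le zero_le_one] at hx
    simp only [hnorm, hfp x hx]
  have hderiv : ∫ x in (0:ℝ)..1, deriv (fun x => (1 - x) * (p x * p x + q x * q x)) x =
      ∫ x in (0:ℝ)..1, ((1 - x) * (2 * ((f' x).re * p x + (f' x).im * q x))
        - (p x * p x + q x * q x)) := by
    refine integral_congr_ae ?_
    filter_upwards [hre.ae_hasDerivAt_integral, him.ae_hasDerivAt_integral] with x h1 h2 hx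
    have hx' := uIoc_subset_uIcc hx
    have d1 : HasDerivAt p (f' x).re x := (h1 hx' 0 (by simp)).const_add _
    have d2 : HasDerivAt q (f' x).im x := (h2 hx' 0 (by simp)).const_add _
    have d3 : HasDerivAt (fun x : ℝ => 1 - x) (-1) x := (hasDerivAt_id x).const_sub 1
    refine ((d3.fun_mul ((d1.fun_mul d1).fun_add (d2.fun_mul d2))).deriv).trans ?_
    ring
  have hwc : ContinuousOn (fun x : ℝ => 1 - x) (uIcc 0 1) := by fun_prop
  have hint : IntervalIntegrable
      (fun x => (1 - x) * (2 * ((f' x).re * p x + (f' x).im * q x))) volume 0 1 :=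
    (((hre.mul_continuousOn hpac.continuousOn).add
      (him.mul_continuousOn hqac.continuousOn)).const_mul 2).continuousOn_mul hwc
  have hint2 : IntervalIntegrable (fun x => p x * p x + q x * q x) volume 0 1 :=
    ((hpac.continuousOn.mul hpac.continuousOn).add
      (hqac.continuousOn.mul hqac.continuousOn)).intervalIntegrable
  have key := hHac.integral_deriv_eq_sub
  rw [hderiv, integral_sub hint hint2, hp0, hq0, ← hnorm] at key
  rw [hpair, hsq]
  linarith

theorem intervalIntegrable_weightedPairing {f g : ℝ → ℂ}
    (hf : MemLp f 2 (volume.restrict (Ioc (0:ℝ) 1)))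
    (hg : MemLp g 2 (volume.restrict (Ioc (0:ℝ) 1))) :
    IntervalIntegrable (fun x => (1 - x) * (2 * ((f x).re * (g x).re + (f x).im * (g x).im)))
      volume 0 1 := by
  have h : IntervalIntegrable (fun x => (f x).re * (g x).re + (f x).im * (g x).im) volume 0 1 := by
    rw [intervalIntegrable_iff_integrableOn_Ioc_of_le zero_le_one]
    exact (hf.re.integrable_mul hg.re).add (hf.im.integrable_mul hg.im)
  exact (h.const_mul 2).continuousOn_mul (by fun_prop)

theorem abs_weightedPairing_le {f g : ℝ → ℂ}
    (hf : MemLp f 2 (volume.restrict (Ioc (0:ℝ) 1)))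
    (hg : MemLp g 2 (volume.restrict (Ioc (0:ℝ) 1))) :
    |weightedPairing f g| ≤ 2 * (L2norm f * L2norm g) := by
  have hcs : ∫ x in (0:ℝ)..1, ‖f x‖ * ‖g x‖ ≤ L2norm f * L2norm g := by
    have h := integral_mul_norm_le_Lp_mul_Lq (μ := volume.restrict (Ioc (0:ℝ) 1))
      (f := f) (g := g) Real.HolderConjugate.two_two (by simpa using hf) (by simpa using hg)
    simpa [L2norm, integral_of_le zero_le_one] using h
  have hint : IntervalIntegrable (fun x => ‖f x‖ * ‖g x‖) volume 0 1 := by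
    rw [intervalIntegrable_iff_integrableOn_Ioc_of_le zero_le_one]
    exact hf.norm.integrable_mul hg.norm
  have hle : ‖weightedPairing f g‖ ≤ ∫ x in (0:ℝ)..1, 2 * (‖f x‖ * ‖g x‖) := by
    refine norm_integral_le_of_norm_le zero_le_one (Eventually.of_forall fun x hx => ?_)
      (hint.const_mul 2)
    have hre : (f x * (starRingEnd ℂ) (g x)).re = (f x).re * (g x).re + (f x).im * (g x).im := by
      simp
    have habs := Complex.abs_re_le_norm (f x * (starRingEnd ℂ) (g x))
    rw [hre, norm_mul, RCLike.norm_conj] at habs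
    have hw : |1 - x| ≤ 1 := abs_le.2 ⟨by linarith [hx.2], by linarith [hx.1]⟩
    rw [Real.norm_eq_abs, abs_mul, abs_mul, abs_two]
    nlinarith [abs_nonneg ((f x).re * (g x).re + (f x).im * (g x).im)]
  rw [intervalIntegral.integral_const_mul, Real.norm_eq_abs] at hle
  linarith

theorem L2norm_nonneg (f : ℝ → ℂ) : 0 ≤ L2norm f :=
  Real.rpow_nonneg (integral_nonneg zero_le_one fun _ _ => by positivity) _

theorem L2norm_sq (f : ℝ → ℂ) : L2norm f ^ 2 = ∫ x in (0:ℝ)..1, ‖f x‖ ^ 2 := by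
  rw [L2norm, ← Real.sqrt_eq_rpow,
    Real.sq_sqrt (integral_nonneg zero_le_one fun _ _ => by positivity)]

/-- Boundary trace estimate: there is `C > 0` depending only on `κ` such
that any solution of `w' + λ²u = F` with `w = u' − κθ` absolutely continuous satisfies
`|w(0)|² ≤ C(‖w‖² + λ²‖u‖² + ‖F‖‖w‖ + λ²‖θ‖‖u‖)`. -/
theorem stmt_15 (κ : ℝ) (hκ : 0 < κ) :
    ∃ C > (0:ℝ), ∀ (lam : ℝ) (u u' θ F w' : ℝ → ℂ),
      -- u absolutely continuous with u(0) = 0 and u' ∈ L²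
      IntervalIntegrable u' volume 0 1 →
      (∀ x ∈ Icc (0:ℝ) 1, u x = u 0 + ∫ s in (0:ℝ)..x, u' s) →
      u 0 = 0 →
      MemLp u' 2 (volume.restrict (Ioc (0:ℝ) 1)) →
      -- θ ∈ L², F ∈ L²
      MemLp θ 2 (volume.restrict (Ioc (0:ℝ) 1)) →
      MemLp F 2 (volume.restrict (Ioc (0:ℝ) 1)) →
      -- w := u' − κθ is absolutely continuous on [0,1] with a.e. derivative w' ∈ L²
      IntervalIntegrable w' volume 0 1 →
      (∀ x ∈ Icc (0:ℝ) 1, u' x - (κ : ℂ) * θ x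
        = (u' 0 - (κ : ℂ) * θ 0) + ∫ s in (0:ℝ)..x, w' s) →
      MemLp w' 2 (volume.restrict (Ioc (0:ℝ) 1)) →
      -- the equation w' + λ²u = F a.e. on (0,1)
      (∀ᵐ x ∂volume, x ∈ Ioo (0:ℝ) 1 → w' x + (lam : ℂ) ^ 2 * u x = F x) →
      ‖u' 0 - (κ : ℂ) * θ 0‖ ^ 2
        ≤ C * (L2norm (fun x => u' x - (κ : ℂ) * θ x) ^ 2
            + lam ^ 2 * L2norm u ^ 2
            + L2norm F * L2norm (fun x => u' x - (κ : ℂ) * θ x)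
            + lam ^ 2 * L2norm θ * L2norm u) := by
  refine ⟨2 + 2 * κ, by positivity, ?_⟩
  intro lam u u' θ F w' hu'i hu hu0 hu' hθ hF hw'i hw hw' heq
  set w : ℝ → ℂ := fun x => u' x - (κ : ℂ) * θ x with hwdef
  have hwL : MemLp w 2 (volume.restrict (Ioc (0:ℝ) 1)) := hu'.sub (hθ.const_mul _)
  have huL : MemLp u 2 (volume.restrict (Ioc (0:ℝ) 1)) := by
    have hc : ContinuousOn u (Icc 0 1) := by
      have h := continuousOn_primitive_interval'
        (μ := volume) (a := (0:ℝ)) hu'i (by simp)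
      rw [uIcc_of_le zero_le_one] at h
      exact (continuousOn_const.add h).congr hu
    obtain ⟨M, hM⟩ := isCompact_Icc.exists_bound_of_continuousOn hc
    refine MemLp.of_bound
      ((hc.mono Ioc_subset_Icc_self).aestronglyMeasurable measurableSet_Ioc) M ?_
    filter_upwards [ae_restrict_mem measurableSet_Ioc] with x hx
    exact hM x (Ioc_subset_Icc_self hx)
  have ew : weightedPairing w' w = L2norm w ^ 2 - ‖w 0‖ ^ 2 := by
    rw [L2norm_sq, weightedPairing_deriv_self hw'i hw]
  have eu : weightedPairing u' u = L2norm u ^ 2 := by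
    rw [L2norm_sq, weightedPairing_deriv_self hu'i hu, hu0]
    simp
  have split : weightedPairing w' w = weightedPairing F w
      - lam ^ 2 * weightedPairing u' u + lam ^ 2 * κ * weightedPairing θ u := by
    unfold weightedPairing
    have i1 := intervalIntegrable_weightedPairing hF hwL
    have i2 := (intervalIntegrable_weightedPairing hu' huL).const_mul (lam ^ 2)
    have i3 := (intervalIntegrable_weightedPairing hθ huL).const_mul (lam ^ 2 * κ)
    rw [← intervalIntegral.integral_const_mul, ← intervalIntegral.integral_const_mul,
      ← integral_sub i1 i2, ← integral_add (i1.sub i2) i3]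
    refine integral_congr_ae ?_
    filter_upwards [heq, Measure.ae_ne volume (1:ℝ)] with x hx hx1 hxI
    rw [uIoc_of_le zero_le_one] at hxI
    have hFx := hx ⟨hxI.1, lt_of_le_of_ne hxI.2 hx1⟩
    have hlam : (lam : ℂ) ^ 2 = ((lam ^ 2 : ℝ) : ℂ) := by push_cast; rfl
    rw [hlam] at hFx
    simp only [← hFx, hwdef, Complex.add_re, Complex.add_im, Complex.sub_re, Complex.sub_im,
      Complex.re_ofReal_mul, Complex.im_ofReal_mul]
    ring
  have bF := (abs_le.1 (abs_weightedPairing_le hF hwL)).1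
  have bθ := (abs_le.1 (abs_weightedPairing_le hθ huL)).1
  have n1 := mul_nonneg (L2norm_nonneg F) (L2norm_nonneg w)
  have n2 := mul_nonneg (sq_nonneg lam) (mul_nonneg (L2norm_nonneg θ) (L2norm_nonneg u))
  have n3 := mul_nonneg (sq_nonneg lam) (sq_nonneg (L2norm u))
  have n4 := sq_nonneg (L2norm w)
  have bθ' := mul_le_mul_of_nonneg_left bθ (mul_nonneg (sq_nonneg lam) hκ.le)
  change ‖w 0‖ ^ 2 ≤ _
  rw [ew, eu] at split
  nlinarith [mul_nonneg hκ.le n1, mul_nonneg hκ.le n3, mul_nonneg hκ.le n4]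
end
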